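/- Let 2 < p < ∞, define p* by 1/p* = 1/2 + 1/p, and let r > 0. Then there exists C_{r,p} < ∞ such that for every n > 1, every z₀ in the closed unit disc, and every function a continuously differentiable on a neighbourhood of the closed unit disc, one has ‖ 𝒞( e^{−inR(·,z₀)} a ) ‖_{L^p(Ω)} ≤ C_{r,p} n^{r − 1/p*} ‖a‖_{W^{1,p}(Ω)}. -/

import Mathlib

open Complex MeasureTheory

/-- Wirtinger derivative `∂`. -/
noncomputable def wdz (g : ℂ → ℂ) (z : ℂ) : ℂ :=
  (fderiv ℝ g z 1 - Complex.I * fderiv ℝ g z Complex.I) / 2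

/-- Wirtinger derivative `∂̄`. -/
noncomputable def wdzbar (g : ℂ → ℂ) (z : ℂ) : ℂ :=
  (fderiv ℝ g z 1 + Complex.I * fderiv ℝ g z Complex.I) / 2

/-- The `W^{1,l}(Ω)` norm `‖g‖_{L^l(Ω)} + ‖∂g‖_{L^l(Ω)} + ‖∂̄g‖_{L^l(Ω)}`,
where `Ω` is the open unit disc. -/
noncomputable def W1Norm (g : ℂ → ℂ) (l : ℝ) : ℝ :=
  (eLpNorm g (ENNReal.ofReal l) (volume.restrict (Metric.ball (0 : ℂ) 1))).toReal +
  (eLpNorm (wdz g) (ENNReal.ofReal l) (volume.restrict (Metric.ball (0 : ℂ) 1))).toReal +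
  (eLpNorm (wdzbar g) (ENNReal.ofReal l) (volume.restrict (Metric.ball (0 : ℂ) 1))).toReal

open scoped ENNReal

theorem lintegral_enorm_inv_rpow_ball_lt_top {q : ℝ} (hq0 : 0 ≤ q) (hq : q < 2) :
    ∫⁻ u in Metric.ball (0 : ℂ) 2, ‖u⁻¹‖ₑ ^ q < ∞ := by
  have hmeas : Measurable fun u : ℂ => ‖u⁻¹‖ ^ q := by fun_prop
  have h : IntegrableOn (fun u : ℂ => ‖u⁻¹‖ ^ q) (Metric.ball 0 2) volume := by
    refine integrableOn_ball_of_norm_le_rpow (C := 1) (α := q) (by simp) (by simpa using hq) ?_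
      hmeas.aestronglyMeasurable
    refine Filter.Eventually.of_forall fun u => ?_
    rw [norm_inv, Real.inv_rpow (norm_nonneg _), ← Real.rpow_neg (norm_nonneg _), one_mul,
      Real.norm_of_nonneg (by positivity)]
  have h2 := h.2
  rw [hasFiniteIntegral_iff_enorm] at h2
  refine lt_of_eq_of_lt (lintegral_congr fun u => ?_) h2
  rw [Real.enorm_rpow_of_nonneg (norm_nonneg _) hq0, enorm_norm]

theorem lintegral_enorm_inv_sub_rpow_le (q : ℝ) {z : ℂ} (hz : z ∈ Metric.closedBall (0 : ℂ) 1) :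
    ∫⁻ w in Metric.ball (0 : ℂ) 1, ‖(z - w)⁻¹‖ₑ ^ q ≤
      ∫⁻ u in Metric.ball (0 : ℂ) 2, ‖u⁻¹‖ₑ ^ q := by
  rw [← lintegral_indicator measurableSet_ball, ← lintegral_indicator measurableSet_ball,
    ← lintegral_sub_left_eq_self ((Metric.ball (0 : ℂ) 2).indicator fun u => ‖u⁻¹‖ₑ ^ q) z]
  refine lintegral_mono fun w => ?_
  by_cases hw : w ∈ Metric.ball (0 : ℂ) 1
  · have : z - w ∈ Metric.ball (0 : ℂ) 2 := by
      rw [mem_ball_zero_iff] at hw ⊢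
      rw [mem_closedBall_zero_iff] at hz
      linarith [norm_sub_le z w]
    simp [hw, this]
  · simp [hw]

theorem rpow_split_mul {a b : ℝ≥0∞} {p q s : ℝ} (hp : 0 < p) (hq : 0 < q) (hs : 0 < s)
    (hqp : q ≤ p) (hsp : s ≤ p) :
    (a ^ s * b ^ q) ^ (1 / p) * (a ^ s) ^ (1 / s - 1 / p) * (b ^ q) ^ (1 / q - 1 / p) = a * b := by
  have h1 : 0 ≤ 1 / s - 1 / p := sub_nonneg.2 (one_div_le_one_div_of_le hs hsp)
  have h2 : 0 ≤ 1 / q - 1 / p := sub_nonneg.2 (one_div_le_one_div_of_le hq hqp)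
  have key : ∀ (x : ℝ≥0∞) (t : ℝ), 0 < t → 0 ≤ 1 / t - 1 / p →
      (x ^ t) ^ (1 / p) * (x ^ t) ^ (1 / t - 1 / p) = x := fun x t ht h => by
    rw [← ENNReal.rpow_add_of_nonneg _ _ (by positivity) h, ← ENNReal.rpow_mul]
    have : t * (1 / p + (1 / t - 1 / p)) = 1 := by field_simp; ring
    rw [this, ENNReal.rpow_one]
  rw [ENNReal.mul_rpow_of_nonneg _ _ (by positivity)]
  calc _ = ((a ^ s) ^ (1 / p) * (a ^ s) ^ (1 / s - 1 / p)) *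
        ((b ^ q) ^ (1 / p) * (b ^ q) ^ (1 / q - 1 / p)) := by ring
    _ = a * b := by rw [key a s hs h1, key b q hq h2]

theorem lintegral_mul_le_three {α : Type*} [MeasurableSpace α] {μ : Measure α} {f k : α → ℝ≥0∞}
    (hf : AEMeasurable f μ) (hk : AEMeasurable k μ) {p q s : ℝ} (hp : 0 < p) (hq : 0 < q)
    (hs : 0 < s) (hqp : q ≤ p) (hsp : s ≤ p) (hpqs : 1 + 1 / p = 1 / q + 1 / s) :
    ∫⁻ w, f w * k w ∂μ ≤ (∫⁻ w, f w ^ s * k w ^ q ∂μ) ^ (1 / p) *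
      (∫⁻ w, f w ^ s ∂μ) ^ (1 / s - 1 / p) * (∫⁻ w, k w ^ q ∂μ) ^ (1 / q - 1 / p) := by
  have h1 : 0 ≤ 1 / s - 1 / p := sub_nonneg.2 (one_div_le_one_div_of_le hs hsp)
  have h2 : 0 ≤ 1 / q - 1 / p := sub_nonneg.2 (one_div_le_one_div_of_le hq hqp)
  have := ENNReal.lintegral_prod_norm_pow_le (μ := μ) (Finset.univ : Finset (Fin 3))
    (f := ![fun w => f w ^ s * k w ^ q, fun w => f w ^ s, fun w => k w ^ q])
    (p := ![1 / p, 1 / s - 1 / p, 1 / q - 1 / p])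
    (by
      intro i _
      fin_cases i
      · exact (hf.pow_const s).mul (hk.pow_const q)
      · exact hf.pow_const s
      · exact hk.pow_const q)
    (by simp [Fin.sum_univ_three] at hpqs ⊢; linarith)
    (by
      intro i _
      fin_cases i
      · simpa using hp.le
      · exact h1
      · exact h2)
  simp only [Fin.prod_univ_three, Matrix.cons_val_zero, Matrix.cons_val_one,
    Matrix.cons_val] at this
  simpa only [rpow_split_mul hp hq hs hqp hsp] using this

/-- Young's inequality on the disc for the Cauchy kernel. -/
theorem lintegral_cauchy_rpow_le {f : ℂ → ℝ≥0∞} (hf : Measurable f) {p q s : ℝ} (hp : 0 < p)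
    (hq : 0 < q) (hs : 0 < s) (hqp : q ≤ p) (hsp : s ≤ p) (hpqs : 1 + 1 / p = 1 / q + 1 / s) :
    ∫⁻ z in Metric.ball (0 : ℂ) 1,
        (∫⁻ w in Metric.ball (0 : ℂ) 1, f w * ‖(z - w)⁻¹‖ₑ) ^ p ≤
      (∫⁻ u in Metric.ball (0 : ℂ) 2, ‖u⁻¹‖ₑ ^ q) ^ (p / q) *
        (∫⁻ w in Metric.ball (0 : ℂ) 1, f w ^ s) ^ (p / s) := by
  set K := ∫⁻ u in Metric.ball (0 : ℂ) 2, ‖u⁻¹‖ₑ ^ q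
  set A := ∫⁻ w in Metric.ball (0 : ℂ) 1, f w ^ s
  have h1 : 0 ≤ p / s - 1 := sub_nonneg.2 ((one_le_div hs).2 hsp)
  have h2 : 0 ≤ p / q - 1 := sub_nonneg.2 ((one_le_div hq).2 hqp)
  have hm : Measurable fun x : ℂ × ℂ => ‖(x.1 - x.2)⁻¹‖ₑ ^ q := by fun_prop
  have hm2 : Measurable fun x : ℂ × ℂ => f x.2 ^ s * ‖(x.1 - x.2)⁻¹‖ₑ ^ q :=
    ((hf.comp measurable_snd).pow_const s).mul hm
  have key : ∀ z ∈ Metric.ball (0 : ℂ) 1,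
      (∫⁻ w in Metric.ball (0 : ℂ) 1, f w * ‖(z - w)⁻¹‖ₑ) ^ p ≤
        (∫⁻ w in Metric.ball (0 : ℂ) 1, f w ^ s * ‖(z - w)⁻¹‖ₑ ^ q) *
          (A ^ (p / s - 1) * K ^ (p / q - 1)) := by
    intro z hz
    have hK := lintegral_enorm_inv_sub_rpow_le q (Metric.ball_subset_closedBall hz)
    refine (ENNReal.rpow_le_rpow (lintegral_mul_le_three hf.aemeasurable (by fun_prop) hp hq hs
      hqp hsp hpqs) hp.le).trans ?_
    rw [ENNReal.mul_rpow_of_nonneg _ _ hp.le, ENNReal.mul_rpow_of_nonneg _ _ hp.le,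
      ← ENNReal.rpow_mul, ← ENNReal.rpow_mul, ← ENNReal.rpow_mul, one_div_mul_cancel hp.ne',
      ENNReal.rpow_one, mul_assoc]
    have e1 : (1 / s - 1 / p) * p = p / s - 1 := by field_simp
    have e2 : (1 / q - 1 / p) * p = p / q - 1 := by field_simp
    rw [e1, e2]
    gcongr
  calc _ ≤ ∫⁻ z in Metric.ball (0 : ℂ) 1,
        (∫⁻ w in Metric.ball (0 : ℂ) 1, f w ^ s * ‖(z - w)⁻¹‖ₑ ^ q) *
          (A ^ (p / s - 1) * K ^ (p / q - 1)) := setLIntegral_mono' measurableSet_ball key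
    _ = (∫⁻ z in Metric.ball (0 : ℂ) 1, ∫⁻ w in Metric.ball (0 : ℂ) 1,
          f w ^ s * ‖(z - w)⁻¹‖ₑ ^ q) * (A ^ (p / s - 1) * K ^ (p / q - 1)) :=
        lintegral_mul_const _ hm2.lintegral_prod_right'
    _ = (∫⁻ w in Metric.ball (0 : ℂ) 1, ∫⁻ z in Metric.ball (0 : ℂ) 1,
          f w ^ s * ‖(z - w)⁻¹‖ₑ ^ q) * (A ^ (p / s - 1) * K ^ (p / q - 1)) := by
        rw [lintegral_lintegral_swap hm2.aemeasurable]
    _ ≤ (A * K) * (A ^ (p / s - 1) * K ^ (p / q - 1)) := by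
        gcongr
        rw [← lintegral_mul_const _ (hf.pow_const s)]
        refine setLIntegral_mono' measurableSet_ball fun w hw => ?_
        rw [lintegral_const_mul _ (by fun_prop)]
        gcongr
        refine le_trans (le_of_eq (lintegral_congr fun z => ?_))
          (lintegral_enorm_inv_sub_rpow_le q (Metric.ball_subset_closedBall hw))
        rw [← neg_sub, inv_neg, enorm_neg]
    _ = (A ^ (1 : ℝ) * A ^ (p / s - 1)) * (K ^ (1 : ℝ) * K ^ (p / q - 1)) := by
        rw [ENNReal.rpow_one, ENNReal.rpow_one]; ring
    _ = _ := by
        rw [← ENNReal.rpow_add_of_nonneg _ _ zero_le_one h1,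
          ← ENNReal.rpow_add_of_nonneg _ _ zero_le_one h2, mul_comm]
        congr 2 <;> ring


theorem lintegral_comp_lineMap_le {g : ℂ → ℝ≥0∞} (hg : Measurable g) (x : ℂ) {t : ℝ} (ht : 0 < t) :
    ∫⁻ y, g (x + t • (y - x)) = ENNReal.ofReal (t ^ (-2 : ℝ)) * ∫⁻ u, g u := by
  have h1 : ∀ y : ℂ, g (x + t • (y - x)) = (fun u => g ((x - t • x) + u)) (t • y) := fun y => by
    simp only
    congr 1
    rw [smul_sub]; ring
  have hm : Measurable fun u => g ((x - t • x) + u) := hg.comp (measurable_const_add _)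
  simp_rw [h1]
  rw [← lintegral_map (f := fun u => g ((x - t • x) + u)) hm (measurable_const_smul t),
    Measure.map_addHaar_smul _ ht.ne', lintegral_smul_measure, lintegral_add_left_eq_self g]
  rw [smul_eq_mul, Complex.finrank_real_complex, abs_of_pos (by positivity),
    Real.rpow_neg ht.le]
  norm_cast

theorem lintegral_comp_lineMap_disc_le {φ : ℂ → ℝ≥0∞} (hφ : Measurable φ) {p : ℝ} (hp : 1 < p)
    (x : ℂ) {t : ℝ} (ht : 0 < t) :
    ∫⁻ y in Metric.ball (0 : ℂ) 1, φ (x + t • (y - x)) ≤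
      ENNReal.ofReal (t ^ (-2 / p)) * ((∫⁻ u, φ u ^ p) ^ (1 / p) *
        volume (Metric.ball (0 : ℂ) 1) ^ (1 - 1 / p)) := by
  have hp0 : 0 < p := by linarith
  have hm : Measurable fun y : ℂ => φ (x + t • (y - x)) := hφ.comp (by fun_prop)
  have hpq : p.HolderConjugate (p / (p - 1)) := Real.HolderConjugate.conjExponent hp
  have h := ENNReal.lintegral_mul_le_Lp_mul_Lq (volume.restrict (Metric.ball (0 : ℂ) 1)) hpq
    hm.aemeasurable (aemeasurable_const (b := (1 : ℝ≥0∞)))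
  simp only [Pi.mul_apply, mul_one, ENNReal.one_rpow, lintegral_one,
    Measure.restrict_apply_univ] at h
  refine h.trans ?_
  have e : 1 / (p / (p - 1)) = 1 - 1 / p := by field_simp
  rw [e, ← mul_assoc]
  gcongr
  have h2 : ∫⁻ y in Metric.ball (0 : ℂ) 1, φ (x + t • (y - x)) ^ p ≤
      ENNReal.ofReal (t ^ (-2 : ℝ)) * ∫⁻ u, φ u ^ p := by
    rw [← lintegral_comp_lineMap_le (hφ.pow_const p) x ht]
    exact setLIntegral_le_lintegral _ _
  refine (ENNReal.rpow_le_rpow h2 (by positivity)).trans ?_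
  rw [ENNReal.mul_rpow_of_nonneg _ _ (by positivity),
    ENNReal.ofReal_rpow_of_nonneg (by positivity) (by positivity), ← Real.rpow_mul ht.le]
  refine le_of_eq ?_
  congr 3
  ring

theorem lintegral_ofReal_rpow_lt_top {p : ℝ} (hp : 2 < p) :
    ∫⁻ t in Set.Ioo (0 : ℝ) 1, ENNReal.ofReal (t ^ (-2 / p)) < ∞ := by
  have h : IntegrableOn (fun t : ℝ => t ^ (-2 / p)) (Set.Ioo 0 1) := by
    rw [intervalIntegral.integrableOn_Ioo_rpow_iff one_pos, lt_div_iff₀ (by linarith)]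
    linarith
  refine lt_of_le_of_lt (setLIntegral_mono' measurableSet_Ioo fun t ht => ?_) h.2
  rw [Real.enorm_of_nonneg (Real.rpow_nonneg ht.1.le _)]

theorem enorm_le_add_lintegral_lineMap {a : ℂ → ℂ}
    (ha : ∀ z ∈ Metric.ball (0 : ℂ) 1, DifferentiableAt ℝ a z)
    (ha' : ContinuousOn (fderiv ℝ a) (Metric.ball 0 1)) {x y : ℂ}
    (hx : x ∈ Metric.ball (0 : ℂ) 1) (hy : y ∈ Metric.ball (0 : ℂ) 1) :
    ‖a x‖ₑ ≤ ‖a y‖ₑ + 2 * ∫⁻ t in Set.Ioo (0 : ℝ) 1,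
      (Metric.ball (0 : ℂ) 1).indicator (fun z => ‖fderiv ℝ a z‖ₑ) (x + t • (y - x)) := by
  have hmem : ∀ t ∈ Set.Icc (0 : ℝ) 1, x + t • (y - x) ∈ Metric.ball (0 : ℂ) 1 := fun t ht =>
    (convex_ball (0 : ℂ) 1).add_smul_sub_mem hx hy ht
  have hline : ∀ t : ℝ, HasDerivAt (fun t : ℝ => x + t • (y - x)) (y - x) t := fun t => by
    simpa using ((hasDerivAt_id t).smul_const (y - x)).const_add x
  have hderiv : ∀ t ∈ Set.uIcc (0 : ℝ) 1, HasDerivAt (fun t : ℝ => a (x + t • (y - x)))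
      (fderiv ℝ a (x + t • (y - x)) (y - x)) t := fun t ht => by
    rw [Set.uIcc_of_le zero_le_one] at ht
    exact (ha _ (hmem t ht)).hasFDerivAt.comp_hasDerivAt t (hline t)
  have hcont : ContinuousOn (fun t : ℝ => fderiv ℝ a (x + t • (y - x)) (y - x))
      (Set.uIcc (0 : ℝ) 1) := by
    rw [Set.uIcc_of_le zero_le_one]
    exact (ha'.comp (by fun_prop) hmem).clm_apply continuousOn_const
  have h := intervalIntegral.integral_eq_sub_of_hasDerivAt hderiv hcont.intervalIntegrable
  simp only [one_smul, zero_smul, add_zero, add_sub_cancel] at h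
  rw [intervalIntegral.integral_of_le zero_le_one, integral_Ioc_eq_integral_Ioo] at h
  have h3 : a x = a y - ∫ t in Set.Ioo (0 : ℝ) 1, fderiv ℝ a (x + t • (y - x)) (y - x) := by
    rw [h]; ring
  rw [h3]
  refine enorm_sub_le.trans ?_
  gcongr
  refine (enorm_integral_le_lintegral_enorm _).trans ?_
  rw [← lintegral_const_mul' _ _ (by simp)]
  refine setLIntegral_mono' measurableSet_Ioo fun t ht => ?_
  rw [Set.indicator_of_mem (hmem t ⟨ht.1.le, ht.2.le⟩), mul_comm]
  refine (ContinuousLinearMap.le_opENorm _ _).trans ?_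
  gcongr
  rw [mem_ball_zero_iff] at hx hy
  rw [← ofReal_norm, ← ENNReal.ofReal_ofNat]
  exact ENNReal.ofReal_le_ofReal (by linarith [norm_sub_le y x])

/-- Morrey's inequality on the disc. -/
theorem exists_enorm_le_eLpNorm_add_fderiv {p : ℝ} (hp : 2 < p) :
    ∃ C : ℝ≥0∞, C ≠ ∞ ∧ ∀ a : ℂ → ℂ, (∀ z ∈ Metric.ball (0 : ℂ) 1, DifferentiableAt ℝ a z) →
      ContinuousOn (fderiv ℝ a) (Metric.ball 0 1) → ∀ x ∈ Metric.ball (0 : ℂ) 1,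
      ‖a x‖ₑ ≤ C * (eLpNorm a (ENNReal.ofReal p) (volume.restrict (Metric.ball (0 : ℂ) 1)) +
        eLpNorm (fderiv ℝ a) (ENNReal.ofReal p) (volume.restrict (Metric.ball (0 : ℂ) 1))) := by
  have hp0 : 0 < p := by linarith
  set V := volume (Metric.ball (0 : ℂ) 1) with hV
  have hV0 : V ≠ 0 := (Metric.measure_ball_pos _ _ one_pos).ne'
  have hVt : V ≠ ∞ := measure_ball_lt_top.ne
  set J := ∫⁻ t in Set.Ioo (0 : ℝ) 1, ENNReal.ofReal (t ^ (-2 / p))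
  have hJ : J ≠ ∞ := (lintegral_ofReal_rpow_lt_top hp).ne
  have hp1 : 0 ≤ 1 - 1 / p := by
    rw [sub_nonneg, div_le_one hp0]; linarith
  have hVp : V ^ (1 - 1 / p) ≠ ∞ := ENNReal.rpow_ne_top_of_nonneg hp1 hVt
  refine ⟨V⁻¹ * ((1 + 2 * J) * V ^ (1 - 1 / p)), by finiteness, fun a ha ha' x hx => ?_⟩
  set μ := volume.restrict (Metric.ball (0 : ℂ) 1) with hμ
  have hpn : ENNReal.ofReal p ≠ 0 := by simpa using hp0
  have hpr : (ENNReal.ofReal p).toReal = p := ENNReal.toReal_ofReal hp0.le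
  have hmes : Measurable (fderiv ℝ a) := measurable_fderiv ℝ a
  set φ := (Metric.ball (0 : ℂ) 1).indicator (fun z => ‖fderiv ℝ a z‖ₑ) with hφdef
  have hφ : Measurable φ := hmes.enorm.indicator measurableSet_ball
  have hac : AEStronglyMeasurable a μ :=
    (ContinuousOn.aestronglyMeasurable (fun z hz => (ha z hz).continuousAt.continuousWithinAt)
      measurableSet_ball)
  have hN : (∫⁻ u, φ u ^ p) ^ (1 / p) = eLpNorm (fderiv ℝ a) (ENNReal.ofReal p) μ := by
    rw [eLpNorm_eq_lintegral_rpow_enorm_toReal hpn ENNReal.ofReal_ne_top, hpr, hμ,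
      ← lintegral_indicator measurableSet_ball]
    congr 2
    ext u
    by_cases hu : u ∈ Metric.ball (0 : ℂ) 1
    · simp only [hφdef, Set.indicator_of_mem hu]
    · simp only [hφdef, Set.indicator_of_notMem hu, ENNReal.zero_rpow_of_pos hp0]
  have hA : ∫⁻ y, ‖a y‖ₑ ∂μ ≤ eLpNorm a (ENNReal.ofReal p) μ * V ^ (1 - 1 / p) := by
    rw [← eLpNorm_one_eq_lintegral_enorm]
    refine (eLpNorm_le_eLpNorm_mul_rpow_measure_univ (q := ENNReal.ofReal p) ?_ hac).trans ?_
    · rw [← ENNReal.ofReal_one]; exact ENNReal.ofReal_le_ofReal (by linarith)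
    · simp [hpr, hμ, hV]
  have hB : ∫⁻ y, (∫⁻ t in Set.Ioo (0 : ℝ) 1, φ (x + t • (y - x))) ∂μ ≤
      J * (eLpNorm (fderiv ℝ a) (ENNReal.ofReal p) μ * V ^ (1 - 1 / p)) := by
    rw [lintegral_lintegral_swap]
    · rw [← hN, ← lintegral_mul_const _ (by fun_prop)]
      exact setLIntegral_mono' measurableSet_Ioo fun t ht =>
        lintegral_comp_lineMap_disc_le hφ (by linarith) x ht.1
    · exact (hφ.comp (by fun_prop : Measurable fun q : ℂ × ℝ => x + q.2 • (q.1 - x))).aemeasurable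
  have key : V * ‖a x‖ₑ ≤ (1 + 2 * J) * V ^ (1 - 1 / p) *
      (eLpNorm a (ENNReal.ofReal p) μ + eLpNorm (fderiv ℝ a) (ENNReal.ofReal p) μ) := by
    calc V * ‖a x‖ₑ = ∫⁻ y, ‖a x‖ₑ ∂μ := by simp [hμ, hV, mul_comm]
      _ ≤ ∫⁻ y, (‖a y‖ₑ + 2 * ∫⁻ t in Set.Ioo (0 : ℝ) 1, φ (x + t • (y - x))) ∂μ :=
        setLIntegral_mono' measurableSet_ball fun y hy =>
          enorm_le_add_lintegral_lineMap ha ha' hx hy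
      _ = ∫⁻ y, ‖a y‖ₑ ∂μ + 2 * ∫⁻ y, (∫⁻ t in Set.Ioo (0 : ℝ) 1, φ (x + t • (y - x))) ∂μ := by
        rw [lintegral_add_left' hac.enorm, lintegral_const_mul' _ _ (by simp)]
      _ ≤ eLpNorm a (ENNReal.ofReal p) μ * V ^ (1 - 1 / p) +
          2 * (J * (eLpNorm (fderiv ℝ a) (ENNReal.ofReal p) μ * V ^ (1 - 1 / p))) := by
        gcongr
      _ ≤ eLpNorm a (ENNReal.ofReal p) μ * V ^ (1 - 1 / p) +
          2 * (J * (eLpNorm (fderiv ℝ a) (ENNReal.ofReal p) μ * V ^ (1 - 1 / p))) +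
          (eLpNorm (fderiv ℝ a) (ENNReal.ofReal p) μ * V ^ (1 - 1 / p) +
          2 * (J * (eLpNorm a (ENNReal.ofReal p) μ * V ^ (1 - 1 / p)))) := le_self_add
      _ = _ := by ring
  calc ‖a x‖ₑ = V⁻¹ * (V * ‖a x‖ₑ) := by
        rw [← mul_assoc, ENNReal.inv_mul_cancel hV0 hVt, one_mul]
    _ ≤ _ := by
        rw [mul_assoc]
        gcongr

theorem integrableOn_prod_of_continuous_of_eq_zero {f : ℝ × ℝ → ℂ} (hf : Continuous f) {R : ℝ}
    (hR : ∀ x, R < x.1 → f x = 0) :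
    IntegrableOn f (Set.Ioi (0 : ℝ) ×ˢ Set.Ioo (-Real.pi) Real.pi) := by
  have h1 : IntegrableOn f (Set.Icc 0 R ×ˢ Set.Icc (-Real.pi) Real.pi) :=
    hf.continuousOn.integrableOn_compact (isCompact_Icc.prod isCompact_Icc)
  refine h1.of_forall_sdiff_eq_zero (measurableSet_Ioi.prod measurableSet_Ioo) ?_
  rintro ⟨r, θ⟩ ⟨⟨hr, hθ⟩, h⟩
  refine hR _ ?_
  by_contra hle
  exact h ⟨⟨le_of_lt hr, not_lt.1 hle⟩, hθ.1.le, hθ.2.le⟩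

theorem fderiv_apply_complex (G : ℂ → ℂ) (w : ℂ) (x y : ℝ) :
    fderiv ℝ G w (x + y * Complex.I) = x * fderiv ℝ G w 1 + y * fderiv ℝ G w Complex.I := by
  have : (x + y * Complex.I : ℂ) = x • (1 : ℂ) + y • Complex.I := by simp
  rw [this, map_add, map_smul, map_smul]
  simp

/-- The Cauchy–Pompeiu formula for compactly supported functions. -/
theorem integral_wdzbar_div_sub {G : ℂ → ℂ} (hG : ContDiff ℝ 1 G) (hc : HasCompactSupport G)
    (z : ℂ) : ∫ w, wdzbar G w / (z - w) = Real.pi * G z := by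
  have hD : Continuous (fderiv ℝ G) := hG.continuous_fderiv one_ne_zero
  obtain ⟨R₀, hR₀⟩ := hc.isCompact.isBounded.subset_closedBall z
  have hzero : ∀ w, R₀ < ‖w - z‖ → w ∉ tsupport G := fun w hw hmem => by
    have := hR₀ hmem
    rw [mem_closedBall_iff_norm] at this
    linarith
  set e : ℝ → ℂ := fun θ => Real.cos θ + Real.sin θ * Complex.I with he
  set e' : ℝ → ℂ := fun θ => (-Real.sin θ : ℝ) + Real.cos θ * Complex.I with he'
  have hecont : Continuous e := by fun_prop
  have hecont' : Continuous e' := by fun_prop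
  have hederiv : ∀ θ, HasDerivAt e (e' θ) θ := fun θ => by
    have h1 := (Real.hasDerivAt_cos θ).ofReal_comp
    have h2 := (Real.hasDerivAt_sin θ).ofReal_comp
    exact h1.add (h2.mul_const Complex.I)
  have henorm : ∀ θ, ‖e θ‖ = 1 := fun θ => by
    simp [he]
  have hene : ∀ θ, e θ ≠ 0 := fun θ h => by simpa [h] using henorm θ
  set A : ℝ × ℝ → ℂ := fun x => fderiv ℝ G (z + x.1 * e x.2) (e x.2) with hA
  set B : ℝ × ℝ → ℂ := fun x => fderiv ℝ G (z + x.1 * e x.2) (e' x.2) with hB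
  have hAc : Continuous A := (hD.comp (by fun_prop)).clm_apply (by fun_prop)
  have hBc : Continuous B := (hD.comp (by fun_prop)).clm_apply (by fun_prop)
  have hout : ∀ (r θ : ℝ), max R₀ 0 < r → z + r * e θ ∉ tsupport G := fun r θ hr => by
    refine hzero _ ?_
    rw [add_sub_cancel_left, norm_mul, henorm, mul_one, Complex.norm_real, Real.norm_eq_abs,
      abs_of_pos (lt_of_le_of_lt (le_max_right _ _) hr)]
    exact lt_of_le_of_lt (le_max_left _ _) hr
  have hfd : ∀ (r θ : ℝ), max R₀ 0 < r → fderiv ℝ G (z + r * e θ) = 0 := fun r θ hr => by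
    have h := hout r θ hr
    by_contra h0
    exact h (support_fderiv_subset ℝ h0)
  have hAi : IntegrableOn A (Set.Ioi (0 : ℝ) ×ˢ Set.Ioo (-Real.pi) Real.pi) :=
    integrableOn_prod_of_continuous_of_eq_zero hAc (R := max R₀ 0) fun x hx => by
      simp [hA, hfd x.1 x.2 hx]
  have hBi : IntegrableOn B (Set.Ioi (0 : ℝ) ×ˢ Set.Ioo (-Real.pi) Real.pi) :=
    integrableOn_prod_of_continuous_of_eq_zero hBc (R := max R₀ 0) fun x hx => by
      simp [hB, hfd x.1 x.2 hx]
  have hAint : ∫ x in Set.Ioi (0 : ℝ) ×ˢ Set.Ioo (-Real.pi) Real.pi, A x = -(2 * Real.pi * G z) := by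
    have hAi' := hAi
    rw [IntegrableOn, Measure.volume_eq_prod, ← Measure.prod_restrict] at hAi'
    rw [Measure.volume_eq_prod, ← Measure.prod_restrict, integral_prod_symm _ hAi']
    have hin : ∀ θ : ℝ, ∫ r in Set.Ioi (0 : ℝ), A (r, θ) = - G z := fun θ => by
      have hd : ∀ r : ℝ, HasDerivAt (fun r : ℝ => G (z + r * e θ)) (A (r, θ)) r := fun r => by
        have h1 : HasDerivAt (fun r : ℝ => z + r * e θ) (e θ) r := by
          simpa using ((Complex.ofRealCLM.hasDerivAt (x := r)).mul_const (e θ)).const_add z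
        exact ((hG.differentiable one_ne_zero) _).hasFDerivAt.comp_hasDerivAt r h1
      have hcont : Continuous fun r : ℝ => A (r, θ) := hAc.comp (by fun_prop)
      have hint : IntegrableOn (fun r : ℝ => A (r, θ)) (Set.Ioi 0) := by
        have h1 : IntegrableOn (fun r : ℝ => A (r, θ)) (Set.Icc 0 (max R₀ 0)) :=
          hcont.continuousOn.integrableOn_compact isCompact_Icc
        refine h1.of_forall_sdiff_eq_zero measurableSet_Ioi fun r hr => ?_
        have hr2 : max R₀ 0 < r := by
          by_contra hle
          exact hr.2 ⟨le_of_lt hr.1, not_lt.1 hle⟩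
        simp [hA, hfd r θ hr2]
      have htend : Filter.Tendsto (fun r : ℝ => G (z + r * e θ)) Filter.atTop (nhds 0) := by
        refine tendsto_const_nhds.congr' ?_
        filter_upwards [Filter.eventually_gt_atTop (max R₀ 0)] with r hr
        exact (image_eq_zero_of_notMem_tsupport (hout r θ hr)).symm
      have := integral_Ioi_of_hasDerivAt_of_tendsto (hd 0).continuousAt.continuousWithinAt
        (fun r _ => hd r) hint htend
      simpa using this
    simp_rw [hin]
    rw [setIntegral_const]
    simp [Real.pi_pos.le]
    exact Or.inl (two_mul _).symm
  have hBint : ∫ x in Set.Ioi (0 : ℝ) ×ˢ Set.Ioo (-Real.pi) Real.pi, B x = 0 := by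
    rw [Measure.volume_eq_prod] at hBi ⊢
    rw [setIntegral_prod _ hBi]
    refine setIntegral_eq_zero_of_forall_eq_zero fun r hr => ?_
    have hd : ∀ θ : ℝ, HasDerivAt (fun θ : ℝ => G (z + r * e θ)) (r * B (r, θ)) θ := fun θ => by
      have h1 : HasDerivAt (fun θ : ℝ => z + r * e θ) (r * e' θ) θ :=
        ((hederiv θ).const_mul (r : ℂ)).const_add z
      have h2 := ((hG.differentiable one_ne_zero) (z + r * e θ)).hasFDerivAt.comp_hasDerivAt θ h1
      have h3 : (r : ℂ) * e' θ = r • e' θ := by simp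
      rw [h3, map_smul, Complex.real_smul] at h2
      exact h2
    have h := intervalIntegral.integral_eq_sub_of_hasDerivAt (a := -Real.pi) (b := Real.pi)
      (fun θ _ => hd θ) (Continuous.intervalIntegrable
        (continuous_const.mul (hBc.comp (by fun_prop))) _ _)
    rw [intervalIntegral.integral_const_mul, intervalIntegral.integral_of_le (by linarith [Real.pi_pos]),
      integral_Ioc_eq_integral_Ioo] at h
    have h0 : G (z + r * e Real.pi) - G (z + r * e (-Real.pi)) = 0 := by simp [he]
    rw [h0] at h
    exact (mul_eq_zero.1 h).resolve_left (by exact_mod_cast (ne_of_gt hr))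
  have hpolar : ∀ x ∈ Set.Ioi (0 : ℝ) ×ˢ Set.Ioo (-Real.pi) Real.pi,
      x.1 • (wdzbar G (z + Complex.polarCoord.symm x) / (z - (z + Complex.polarCoord.symm x))) =
        -(1 / 2) * A x + -(Complex.I / 2) * B x := by
    rintro ⟨r, θ⟩ ⟨hr, -⟩
    have hr0 : (r : ℂ) ≠ 0 := by exact_mod_cast (ne_of_gt hr)
    have hsymm : Complex.polarCoord.symm (r, θ) = r * e θ := by
      rw [Complex.polarCoord_symm_apply]
    rw [hsymm]
    simp only [hA, hB, wdzbar]
    set L := fderiv ℝ G (z + r * e θ)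
    have hL1 : L (e θ) = Real.cos θ * L 1 + Real.sin θ * L Complex.I :=
      fderiv_apply_complex _ _ _ _
    have hL2 : L (e' θ) = (-Real.sin θ : ℝ) * L 1 + Real.cos θ * L Complex.I :=
      fderiv_apply_complex _ _ _ _
    have hcs : (Real.cos θ : ℂ) ^ 2 + (Real.sin θ : ℂ) ^ 2 = 1 := by
      exact_mod_cast Real.cos_sq_add_sin_sq θ
    rw [hL1, hL2, sub_add_cancel_left, Complex.real_smul, ← mul_div_assoc,
      div_eq_iff (neg_ne_zero.2 (mul_ne_zero hr0 (hene θ)))]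
    simp only [he]
    push_cast at hcs ⊢
    linear_combination (-(r : ℂ) * (L 1 + Complex.I * L Complex.I) / 2) * (hcs) + r / 2 * (L 1 * Complex.sin θ ^ 2 -
        L Complex.I * Complex.cos θ * Complex.sin θ) * Complex.I_sq
  calc ∫ w, wdzbar G w / (z - w) = ∫ u, wdzbar G (z + u) / (z - (z + u)) :=
        (integral_add_left_eq_self (fun w => wdzbar G w / (z - w)) z).symm
    _ = ∫ x in Set.Ioi (0 : ℝ) ×ˢ Set.Ioo (-Real.pi) Real.pi, x.1 •
          (wdzbar G (z + Complex.polarCoord.symm x) / (z - (z + Complex.polarCoord.symm x))) :=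
        (Complex.integral_comp_polarCoord_symm
          (fun u => wdzbar G (z + u) / (z - (z + u)))).symm
    _ = ∫ x in Set.Ioi (0 : ℝ) ×ˢ Set.Ioo (-Real.pi) Real.pi,
          (-(1 / 2) * A x + -(Complex.I / 2) * B x) :=
        setIntegral_congr_fun (measurableSet_Ioi.prod measurableSet_Ioo) hpolar
    _ = Real.pi * G z := by
        rw [integral_add (hAi.const_mul _) (hBi.const_mul _), integral_const_mul,
          integral_const_mul, hAint, hBint]
        ring

theorem ennreal_rpow_neg_le_rpow_neg {α : ℝ} (hα : 0 ≤ α) {x y : ℝ≥0∞} (h : x ≤ y) :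
    y ^ (-α) ≤ x ^ (-α) := by
  rw [ENNReal.rpow_neg, ENNReal.rpow_neg]
  exact ENNReal.inv_le_inv.2 (ENNReal.rpow_le_rpow h hα)

theorem one_div_one_add_le_rpow_neg {x β : ℝ} (hx : 0 < x) (hβ0 : 0 ≤ β) (hβ1 : β ≤ 1) :
    1 / (1 + x) ≤ x ^ (-β) := by
  rw [Real.rpow_neg hx.le, ← one_div]
  refine one_div_le_one_div_of_le (by positivity) ?_
  rcases le_total x 1 with h | h
  · linarith [Real.rpow_le_one hx.le h hβ0]
  · linarith [(Real.rpow_le_rpow_of_exponent_le h hβ1).trans_eq (Real.rpow_one x)]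

theorem lintegral_ball_one_div_one_add_le {δ : ℝ} (h0 : 0 ≤ δ) (h1 : δ ≤ 1) {n : ℝ} (hn : 0 < n)
    {z₀ : ℂ} (hz₀ : z₀ ∈ Metric.closedBall (0 : ℂ) 1) :
    ∫⁻ w in Metric.ball (0 : ℂ) 1, ENNReal.ofReal (1 / (1 + n * ‖w - z₀‖ ^ 2)) ≤
      ENNReal.ofReal (n ^ (-(1 - δ))) *
        ∫⁻ u in Metric.ball (0 : ℂ) 2, ‖u⁻¹‖ₑ ^ (2 * (1 - δ)) := by
  refine le_trans ?_ (mul_le_mul_right (lintegral_enorm_inv_sub_rpow_le _ hz₀) _)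
  rw [← lintegral_const_mul' _ _ ENNReal.ofReal_ne_top]
  refine lintegral_mono_ae ?_
  filter_upwards [ae_restrict_of_ae (Measure.ae_ne volume z₀)] with w hw
  have hσ : 0 < ‖w - z₀‖ := norm_pos_iff.2 (sub_ne_zero.2 hw)
  rw [← enorm_norm, ← Real.enorm_rpow_of_nonneg (norm_nonneg _) (by linarith),
    Real.enorm_of_nonneg (by positivity), ← ENNReal.ofReal_mul (by positivity)]
  refine ENNReal.ofReal_le_ofReal ((one_div_one_add_le_rpow_neg (by positivity)
    (β := 1 - δ) (by linarith) (by linarith)).trans (le_of_eq ?_))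
  rw [Real.mul_rpow hn.le (by positivity), norm_inv, norm_sub_rev, Real.inv_rpow (by positivity),
    ← Real.rpow_neg (by positivity), ← Real.rpow_natCast, ← Real.rpow_mul (by positivity)]
  congr 2
  push_cast
  ring

theorem lintegral_enorm_sub_rpow_neg_lt_top {α : ℝ} (h1 : α < 1) (c R : ℝ) :
    ∫⁻ x in Metric.ball c R, ‖x - c‖ₑ ^ (-α) < ∞ := by
  have h : IntegrableOn (fun u : ℝ => ‖u‖ ^ (-α)) (Metric.ball 0 R) volume := by
    refine integrableOn_ball_of_norm_le_rpow (C := 1) (α := α) (by simp) (by simpa using h1) ?_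
      (measurable_norm.pow_const _).aestronglyMeasurable
    refine Filter.Eventually.of_forall fun u => ?_
    rw [one_mul, Real.norm_of_nonneg (by positivity)]
  have h2 := h.2
  rw [hasFiniteIntegral_iff_enorm] at h2
  have e : ∫⁻ x in Metric.ball c R, ‖x - c‖ₑ ^ (-α) =
      ∫⁻ x in Metric.ball (0 : ℝ) R, ‖x‖ₑ ^ (-α) := by
    rw [← lintegral_indicator measurableSet_ball, ← lintegral_indicator measurableSet_ball,
      ← lintegral_sub_right_eq_self ((Metric.ball (0 : ℝ) R).indicator fun u => ‖u‖ₑ ^ (-α)) c]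
    refine lintegral_congr fun x => ?_
    simp only [Set.indicator, Metric.mem_ball, dist_eq_norm, sub_zero]
  rw [e]
  refine lt_of_eq_of_lt (lintegral_congr_ae ?_) h2
  filter_upwards [ae_restrict_of_ae (Measure.ae_ne volume (0 : ℝ))] with u hu
  have hu' : 0 < ‖u‖ := norm_pos_iff.2 hu
  rw [Real.enorm_of_nonneg (Real.rpow_nonneg hu'.le (-α)), ← ENNReal.ofReal_rpow_of_pos hu',
    ofReal_norm]

theorem lintegral_abs_sin_rpow_neg_lt_top {α : ℝ} (h0 : 0 < α) (h1 : α < 1) :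
    ∫⁻ θ in Set.Ioo (-Real.pi) Real.pi, ENNReal.ofReal |Real.sin θ| ^ (-α) < ∞ := by
  have hpi := Real.pi_pos
  have hle : ∀ (c : ℝ), |Real.sin c| = 0 → ∀ θ : ℝ, |θ - c| ≤ Real.pi / 2 →
      |Real.sin (θ - c)| = |Real.sin θ| → ENNReal.ofReal |Real.sin θ| ^ (-α) ≤
        ENNReal.ofReal (2 / Real.pi) ^ (-α) * ‖θ - c‖ₑ ^ (-α) := fun c _ θ hθ hs => by
    rw [← ENNReal.mul_rpow_of_ne_top ENNReal.ofReal_ne_top enorm_ne_top,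
      ← ofReal_norm, ← ENNReal.ofReal_mul (by positivity), Real.norm_eq_abs, ← hs]
    exact ennreal_rpow_neg_le_rpow_neg h0.le
      (ENNReal.ofReal_le_ofReal (Real.mul_abs_le_abs_sin hθ))
  set S : ℝ → ℝ≥0∞ := fun c => ∫⁻ θ in Metric.ball c (2 * Real.pi), ‖θ - c‖ₑ ^ (-α)
  have hS : ∀ c, S c < ∞ := fun c => lintegral_enorm_sub_rpow_neg_lt_top h1 c _
  have hc : ENNReal.ofReal (2 / Real.pi) ^ (-α) ≠ ∞ :=
    ENNReal.rpow_ne_top_of_ne_zero (by simpa using by positivity) ENNReal.ofReal_ne_top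
  have hm : ∀ c : ℝ, Measurable fun θ : ℝ => ‖θ - c‖ₑ ^ (-α) := fun c => by fun_prop
  have hsub : ∀ c ∈ Set.Icc (-Real.pi) Real.pi,
      ∫⁻ θ in Set.Ioo (-Real.pi) Real.pi, ‖θ - c‖ₑ ^ (-α) ≤ S c := fun c hc => by
    refine lintegral_mono_set fun θ hθ => ?_
    rw [Metric.mem_ball, Real.dist_eq, abs_lt]
    constructor <;> linarith [hθ.1, hθ.2, hc.1, hc.2]
  calc ∫⁻ θ in Set.Ioo (-Real.pi) Real.pi, ENNReal.ofReal |Real.sin θ| ^ (-α)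
      ≤ ∫⁻ θ in Set.Ioo (-Real.pi) Real.pi, ENNReal.ofReal (2 / Real.pi) ^ (-α) *
          (‖θ - 0‖ₑ ^ (-α) + ‖θ - Real.pi‖ₑ ^ (-α) + ‖θ - -Real.pi‖ₑ ^ (-α)) := by
        refine setLIntegral_mono' measurableSet_Ioo fun θ hθ => ?_
        rw [mul_add, mul_add]
        rcases le_total (Real.pi / 2) θ with h | h
        · refine (hle Real.pi (by simp) θ (abs_le.2 ⟨by linarith, by linarith [hθ.2]⟩)
            (by simp)).trans ?_
          exact (le_add_self).trans le_self_add
        · rcases le_total (-(Real.pi / 2)) θ with h' | h'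
          · exact (hle 0 (by simp) θ (abs_le.2 ⟨by linarith, by linarith⟩) (by simp)).trans
              (le_self_add.trans le_self_add)
          · refine (hle (-Real.pi) (by simp) θ (abs_le.2 ⟨by linarith [hθ.1], by linarith⟩)
              (by simp)).trans le_add_self
    _ = ENNReal.ofReal (2 / Real.pi) ^ (-α) *
          ((∫⁻ θ in Set.Ioo (-Real.pi) Real.pi, ‖θ - 0‖ₑ ^ (-α)) +
          (∫⁻ θ in Set.Ioo (-Real.pi) Real.pi, ‖θ - Real.pi‖ₑ ^ (-α)) +
          ∫⁻ θ in Set.Ioo (-Real.pi) Real.pi, ‖θ - -Real.pi‖ₑ ^ (-α)) := by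
        rw [lintegral_const_mul' _ _ hc, lintegral_add_left (by fun_prop),
          lintegral_add_left (hm _)]
    _ ≤ ENNReal.ofReal (2 / Real.pi) ^ (-α) * (S 0 + S Real.pi + S (-Real.pi)) := by
        gcongr <;> exact hsub _ ⟨by linarith, by linarith⟩
    _ < ∞ := by
        have := hS 0
        have := hS Real.pi
        have := hS (-Real.pi)
        finiteness

theorem lintegral_ball_boundary_weight_lt_top {α : ℝ} (h0 : 0 < α) (h1 : α < 1) :
    ∫⁻ v in Metric.ball (0 : ℂ) 1, ENNReal.ofReal ((1 - ‖v‖ ^ 2) * |v.im|) ^ (-α) < ∞ := by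
  rw [← lintegral_indicator measurableSet_ball, ← Complex.lintegral_comp_polarCoord_symm]
  have hm1 : Measurable fun r : ℝ =>
      (Set.Ioo (0 : ℝ) 1).indicator (fun r => ENNReal.ofReal (1 - r) ^ (-α)) r :=
    Measurable.indicator (by fun_prop) measurableSet_Ioo
  have hm2 : Measurable fun θ : ℝ => ENNReal.ofReal |Real.sin θ| ^ (-α) := by fun_prop
  have hr : ∫⁻ r in Set.Ioi (0 : ℝ),
      (Set.Ioo (0 : ℝ) 1).indicator (fun r => ENNReal.ofReal (1 - r) ^ (-α)) r < ∞ := by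
    refine lt_of_le_of_lt (setLIntegral_le_lintegral _ _) ?_
    rw [lintegral_indicator measurableSet_Ioo]
    refine lt_of_le_of_lt ?_ (lintegral_enorm_sub_rpow_neg_lt_top h1 1 1)
    refine (setLIntegral_mono' measurableSet_Ioo (fun r hr => ?_)).trans
      (lintegral_mono_set fun r hr => ?_)
    · rw [← ofReal_norm, norm_sub_rev, Real.norm_of_nonneg (by linarith [hr.2])]
    · rw [Metric.mem_ball, Real.dist_eq, abs_lt]
      constructor <;> linarith [hr.1, hr.2]
  refine lt_of_le_of_lt ?_ (ENNReal.mul_lt_top hr (lintegral_abs_sin_rpow_neg_lt_top h0 h1))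
  rw [← lintegral_prod_mul hm1.aemeasurable hm2.aemeasurable, Measure.prod_restrict,
    ← Measure.volume_eq_prod]
  refine setLIntegral_mono' (measurableSet_Ioi.prod measurableSet_Ioo) ?_
  rintro ⟨r, θ⟩ ⟨hr0, -⟩
  simp only [Set.mem_Ioi] at hr0
  have hnorm : ‖Complex.polarCoord.symm (r, θ)‖ = r := by
    rw [Complex.norm_polarCoord_symm, abs_of_pos hr0]
  have him : (Complex.polarCoord.symm (r, θ)).im = r * Real.sin θ := by
    rw [Complex.polarCoord_symm_apply]
    simp [Complex.sin_ofReal_re]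
  by_cases hr1 : r < 1
  · have hmem : Complex.polarCoord.symm (r, θ) ∈ Metric.ball (0 : ℂ) 1 := by
      rwa [mem_ball_zero_iff, hnorm]
    rw [Set.indicator_of_mem hmem, Set.indicator_of_mem (show r ∈ Set.Ioo (0 : ℝ) 1 from ⟨hr0, hr1⟩),
      hnorm, him, smul_eq_mul, abs_mul, abs_of_pos hr0]
    have hr2 : 0 < 1 - r ^ 2 := by nlinarith
    rw [← mul_assoc, mul_comm _ r, mul_assoc, ENNReal.ofReal_mul hr0.le,
      ENNReal.ofReal_mul hr2.le, ENNReal.mul_rpow_of_ne_top (by simp) (by finiteness),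
      ENNReal.mul_rpow_of_ne_top (by simp) (by simp), ← mul_assoc]
    have hA : ENNReal.ofReal r * ENNReal.ofReal r ^ (-α) ≤ 1 := by
      rw [ENNReal.ofReal_rpow_of_pos hr0, ← ENNReal.ofReal_mul hr0.le, ← ENNReal.ofReal_one]
      refine ENNReal.ofReal_le_ofReal ?_
      calc r * r ^ (-α) = r ^ (1 - α) := by
            rw [sub_eq_add_neg, Real.rpow_add hr0, Real.rpow_one]
        _ ≤ 1 := Real.rpow_le_one hr0.le hr1.le (by linarith)
    calc _ ≤ 1 * (ENNReal.ofReal (1 - r ^ 2) ^ (-α) * ENNReal.ofReal |Real.sin θ| ^ (-α)) := by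
          gcongr
      _ ≤ _ := by
          rw [one_mul]
          refine mul_le_mul_left (ennreal_rpow_neg_le_rpow_neg h0.le
            (ENNReal.ofReal_le_ofReal (by nlinarith))) _
  · have hmem : Complex.polarCoord.symm (r, θ) ∉ Metric.ball (0 : ℂ) 1 := by
      rwa [mem_ball_zero_iff, hnorm]
    rw [Set.indicator_of_notMem hmem]
    simp

theorem abs_im_conj_mul_le {z₀ : ℂ} {u : ℂ} {t : ℝ} (hu : ‖u‖ = 1) (hz : z₀ = t * u) (w : ℂ) :
    |((starRingEnd ℂ) u * w).im| ≤ ‖w - z₀‖ := by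
  have h1 : ((starRingEnd ℂ) u * w).im = ((starRingEnd ℂ) u * (w - z₀)).im := by
    have : (starRingEnd ℂ) u * (w - z₀) = (starRingEnd ℂ) u * w - (t : ℂ) := by
      rw [hz, mul_sub]
      congr 1
      rw [mul_left_comm, mul_comm _ u, Complex.mul_conj, Complex.normSq_eq_norm_sq, hu]
      simp
    rw [this]; simp
  rw [h1]
  refine (Complex.abs_im_le_norm _).trans ?_
  rw [norm_mul, Complex.norm_conj, hu, one_mul]

theorem lintegral_ball_one_div_one_add_boundary_le {δ : ℝ} (h0 : 0 ≤ δ) (h1 : δ < 1) {n : ℝ}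
    (hn : 0 < n) (z₀ : ℂ) :
    ∫⁻ w in Metric.ball (0 : ℂ) 1,
        ENNReal.ofReal (1 / (1 + (n * ((1 - ‖w‖ ^ 2) * ‖w - z₀‖)) ^ 2)) ≤
      ENNReal.ofReal (n ^ (-(1 - δ))) * ∫⁻ v in Metric.ball (0 : ℂ) 1,
        ENNReal.ofReal ((1 - ‖v‖ ^ 2) * |v.im|) ^ (-(1 - δ)) := by
  obtain ⟨u, t, hu, hz⟩ : ∃ (u : ℂ) (t : ℝ), ‖u‖ = 1 ∧ z₀ = t * u :=
    ⟨Complex.exp (z₀.arg * Complex.I), ‖z₀‖, Complex.norm_exp_ofReal_mul_I _,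
      (Complex.norm_mul_exp_arg_mul_I z₀).symm⟩
  set c : Circle := ⟨(starRingEnd ℂ) u, by simp [Submonoid.unitSphere, hu]⟩
  set Ψ : ℂ → ℝ≥0∞ := fun v => ENNReal.ofReal ((1 - ‖v‖ ^ 2) * |v.im|) ^ (-(1 - δ)) with hΨ
  have hrot : ∫⁻ v in Metric.ball (0 : ℂ) 1, Ψ v =
      ∫⁻ w in Metric.ball (0 : ℂ) 1, Ψ ((starRingEnd ℂ) u * w) := by
    rw [← lintegral_indicator measurableSet_ball, ← lintegral_indicator measurableSet_ball,
      ← (rotation c).measurePreserving.lintegral_comp_emb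
        (rotation c).toHomeomorph.measurableEmbedding]
    refine lintegral_congr fun w => ?_
    have h2 : ‖(starRingEnd ℂ) u * w‖ = ‖w‖ := by
      rw [norm_mul, Complex.norm_conj, hu, one_mul]
    have h3 : rotation c w = (starRingEnd ℂ) u * w := rotation_apply c w
    simp only [Set.indicator, mem_ball_zero_iff, h3, h2]
  rw [hrot, ← lintegral_const_mul' _ _ ENNReal.ofReal_ne_top]
  refine setLIntegral_mono' measurableSet_ball fun w hw => ?_
  rw [mem_ball_zero_iff] at hw
  have hρ : 0 < 1 - ‖w‖ ^ 2 := by nlinarith [norm_nonneg w]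
  have h2 : ‖(starRingEnd ℂ) u * w‖ = ‖w‖ := by
    rw [norm_mul, Complex.norm_conj, hu, one_mul]
  have him := abs_im_conj_mul_le hu hz w
  simp only [hΨ, h2]
  rcases (abs_nonneg ((starRingEnd ℂ) u * w).im).eq_or_lt with h | h
  · rw [← h, mul_zero, ENNReal.ofReal_zero, ENNReal.zero_rpow_of_neg (by linarith),
      ENNReal.mul_top (by simpa using by positivity)]
    exact le_top
  · rw [ENNReal.ofReal_rpow_of_pos (by positivity), ← ENNReal.ofReal_mul (by positivity),
      ← Real.mul_rpow hn.le (by positivity)]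
    refine ENNReal.ofReal_le_ofReal ?_
    set x := n * ((1 - ‖w‖ ^ 2) * |((starRingEnd ℂ) u * w).im|) with hx
    have hx0 : 0 < x := by positivity
    calc _ ≤ 1 / (1 + x ^ 2) := by
          have : x ≤ n * ((1 - ‖w‖ ^ 2) * ‖w - z₀‖) := by rw [hx]; gcongr
          gcongr
      _ ≤ (x ^ 2) ^ (-((1 - δ) / 2)) :=
          one_div_one_add_le_rpow_neg (by positivity) (by linarith) (by linarith)
      _ = x ^ (-(1 - δ)) := by
          rw [← Real.rpow_natCast, ← Real.rpow_mul hx0.le]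
          congr 1
          push_cast
          ring

/-! ### The Wirtinger derivative `∂̄` as a derivation -/

theorem wdzbar_congr {f g : ℂ → ℂ} {w : ℂ} (h : f =ᶠ[nhds w] g) : wdzbar f w = wdzbar g w := by
  rw [wdzbar, wdzbar, h.fderiv_eq]

theorem wdzbar_add {f g : ℂ → ℂ} {w : ℂ} (hf : DifferentiableAt ℝ f w)
    (hg : DifferentiableAt ℝ g w) :
    wdzbar (fun x => f x + g x) w = wdzbar f w + wdzbar g w := by
  simp only [wdzbar, fderiv_fun_add hf hg, add_apply]
  ring

theorem wdzbar_mul {f g : ℂ → ℂ} {w : ℂ} (hf : DifferentiableAt ℝ f w)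
    (hg : DifferentiableAt ℝ g w) :
    wdzbar (fun x => f x * g x) w = wdzbar f w * g w + f w * wdzbar g w := by
  simp only [wdzbar, fderiv_fun_mul hf hg, add_apply,
    smul_apply, smul_eq_mul]
  ring

theorem wdzbar_const_mul {f : ℂ → ℂ} {w : ℂ} (hf : DifferentiableAt ℝ f w) (c : ℂ) :
    wdzbar (fun x => c * f x) w = c * wdzbar f w := by
  rw [wdzbar_mul (differentiableAt_const c) hf]
  simp [wdzbar]

theorem wdzbar_cexp {f : ℂ → ℂ} {w : ℂ} (hf : DifferentiableAt ℝ f w) :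
    wdzbar (fun x => Complex.exp (f x)) w = Complex.exp (f w) * wdzbar f w := by
  simp only [wdzbar, hf.hasFDerivAt.cexp.fderiv, smul_apply, smul_eq_mul]
  ring

theorem wdzbar_sub_const (z₀ w : ℂ) : wdzbar (fun x => x - z₀) w = 0 := by
  simp [wdzbar, fderiv_sub_const]

theorem differentiable_conj_sub (z₀ : ℂ) :
    Differentiable ℝ fun x : ℂ => (starRingEnd ℂ) (x - z₀) := fun w =>
  (Complex.conjCLE.differentiable.comp (differentiable_id.sub_const z₀)) w

theorem wdzbar_conj_sub (z₀ w : ℂ) : wdzbar (fun x => (starRingEnd ℂ) (x - z₀)) w = 1 := by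
  have h : HasFDerivAt (fun x : ℂ => (starRingEnd ℂ) (x - z₀))
      (Complex.conjCLE : ℂ →L[ℝ] ℂ) w := by
    simp only [map_sub]
    exact (Complex.conjCLE : ℂ →L[ℝ] ℂ).hasFDerivAt.sub_const _
  rw [wdzbar, h.fderiv]
  simp

/-- The phase factor `exp (-i n R(w, z₀))`. -/
noncomputable def phase (n : ℝ) (z₀ w : ℂ) : ℂ :=
  Complex.exp (-Complex.I * (n : ℂ) * ((w - z₀) ^ 2 + ((starRingEnd ℂ) (w - z₀)) ^ 2))

theorem norm_phase (n : ℝ) (z₀ w : ℂ) : ‖phase n z₀ w‖ = 1 := by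
  rw [phase, Complex.norm_exp]
  simp [pow_two]
  exact Or.inr (by ring)

theorem contDiff_phase (n : ℝ) (z₀ : ℂ) : ContDiff ℝ 1 (phase n z₀) := by
  have h : ContDiff ℝ 1 fun x : ℂ => (starRingEnd ℂ) (x - z₀) :=
    Complex.conjCLE.contDiff.comp (contDiff_id.sub contDiff_const)
  exact (contDiff_const.mul (((contDiff_id.sub contDiff_const).pow 2).add (h.pow 2))).cexp

theorem wdzbar_phase (n : ℝ) (z₀ w : ℂ) :
    wdzbar (phase n z₀) w =
      -2 * Complex.I * n * (starRingEnd ℂ) (w - z₀) * phase n z₀ w := by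
  have hc := differentiable_conj_sub z₀ w
  have hid : DifferentiableAt ℝ (fun x : ℂ => x - z₀) w := differentiableAt_id.sub_const z₀
  have h : DifferentiableAt ℝ
      (fun x : ℂ => (x - z₀) ^ 2 + ((starRingEnd ℂ) (x - z₀)) ^ 2) w := (hid.fun_pow 2).add (hc.fun_pow 2)
  unfold phase
  rw [wdzbar_cexp (h.const_mul _), wdzbar_const_mul h, wdzbar_add (hid.fun_pow 2) (hc.fun_pow 2)]
  simp only [pow_two]
  rw [wdzbar_mul hid hid, wdzbar_mul hc hc, wdzbar_sub_const, wdzbar_conj_sub]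
  ring

/-! ### The correction term -/

theorem contDiff_max_zero_sq : ContDiff ℝ 1 fun x : ℝ => max x 0 ^ 2 := by
  have hd : ∀ x : ℝ, HasDerivAt (fun x : ℝ => max x 0 ^ 2) (2 * max x 0) x := fun x => by
    rcases lt_trichotomy x 0 with hx | rfl | hx
    · rw [max_eq_right hx.le, mul_zero]
      refine (hasDerivAt_const x (0 : ℝ)).congr_of_eventuallyEq ?_
      filter_upwards [eventually_lt_nhds hx] with y hy
      rw [max_eq_right hy.le]
      simp
    · rw [max_self, mul_zero, hasDerivAt_iff_isLittleO]
      refine Asymptotics.IsBigO.trans_isLittleO (g := fun x : ℝ => x ^ 2) ?_ ?_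
      · refine Asymptotics.IsBigO.of_bound 1 (Filter.Eventually.of_forall fun y => ?_)
        rcases le_total y 0 with h | h
        · simp [h, sq_nonneg]
        · simp [h]
      · simpa using Asymptotics.isLittleO_pow_id (𝕜 := ℝ) (n := 2) (by norm_num)
    · rw [max_eq_left hx.le]
      have h := hasDerivAt_pow 2 x
      simp only [Nat.cast_ofNat, Nat.add_one_sub_one, pow_one] at h
      refine h.congr_of_eventuallyEq ?_
      filter_upwards [eventually_gt_nhds hx] with y hy
      rw [max_eq_left hy.le]
  rw [contDiff_one_iff_deriv]
  refine ⟨fun x => (hd x).differentiableAt, ?_⟩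
  rw [show deriv (fun x : ℝ => max x 0 ^ 2) = fun x => 2 * max x 0 from
    funext fun x => (hd x).deriv]
  fun_prop

/-- A `C¹` weight supported on the closed unit disc, equal to `(1 - |w|²)²` there. -/
noncomputable def discWeight (w : ℂ) : ℝ := max (1 - ‖w‖ ^ 2) 0 ^ 2

theorem contDiff_discWeight : ContDiff ℝ 1 discWeight :=
  contDiff_max_zero_sq.comp (contDiff_const.sub (contDiff_norm_sq ℝ))

theorem discWeight_nonneg (w : ℂ) : 0 ≤ discWeight w := sq_nonneg _

theorem discWeight_eq_zero {w : ℂ} (hw : 1 ≤ ‖w‖) : discWeight w = 0 := by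
  rw [discWeight, max_eq_right (by nlinarith)]
  simp

theorem discWeight_of_mem_ball {w : ℂ} (hw : w ∈ Metric.ball (0 : ℂ) 1) :
    discWeight w = (1 - ‖w‖ ^ 2) ^ 2 := by
  rw [mem_ball_zero_iff] at hw
  rw [discWeight, max_eq_left (by nlinarith [norm_nonneg w])]

/-- The denominator of the correction factor. -/
noncomputable def corrDen (n : ℝ) (z₀ w : ℂ) : ℝ :=
  discWeight w * (n ^ 2 * ‖w - z₀‖ ^ 2 + n) + 1

theorem corrDen_pos {n : ℝ} (hn : 0 ≤ n) (z₀ w : ℂ) : 0 < corrDen n z₀ w := by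
  have := discWeight_nonneg w
  rw [corrDen]
  positivity

/-- The correction factor, a regularisation of `1 / conj (w - z₀)` vanishing on the boundary of
the unit disc. -/
noncomputable def corr (n : ℝ) (z₀ w : ℂ) : ℂ :=
  ((n ^ 2 * discWeight w / corrDen n z₀ w : ℝ) : ℂ) * (w - z₀)

theorem contDiff_corrDen (n : ℝ) (z₀ : ℂ) : ContDiff ℝ 1 (corrDen n z₀) := by
  have h : ContDiff ℝ 1 fun w : ℂ => ‖w - z₀‖ ^ 2 :=
    (contDiff_norm_sq ℝ).comp (contDiff_id.sub contDiff_const)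
  exact (contDiff_discWeight.mul ((contDiff_const.mul h).add contDiff_const)).add contDiff_const

theorem contDiff_corr {n : ℝ} (hn : 0 ≤ n) (z₀ : ℂ) : ContDiff ℝ 1 (corr n z₀) :=
  (Complex.ofRealCLM.contDiff.comp ((contDiff_const.mul contDiff_discWeight).div
    (contDiff_corrDen n z₀) fun w => (corrDen_pos hn z₀ w).ne')).mul
    (contDiff_id.sub contDiff_const)

theorem corr_eq_zero (n : ℝ) (z₀ : ℂ) {w : ℂ} (hw : 1 ≤ ‖w‖) : corr n z₀ w = 0 := by
  simp [corr, discWeight_eq_zero hw]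

theorem one_sub_conj_mul_corr {n : ℝ} (hn : 0 ≤ n) (z₀ w : ℂ) :
    1 - (starRingEnd ℂ) (w - z₀) * corr n z₀ w =
      (((n * discWeight w + 1) / corrDen n z₀ w : ℝ) : ℂ) := by
  have h : (starRingEnd ℂ) (w - z₀) * (w - z₀) = ((‖w - z₀‖ ^ 2 : ℝ) : ℂ) := by
    rw [mul_comm, Complex.mul_conj, Complex.normSq_eq_norm_sq]
  have hD := (corrDen_pos hn z₀ w).ne'
  rw [corr, mul_left_comm, h, ← Complex.ofReal_mul, ← Complex.ofReal_one, ← Complex.ofReal_sub]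
  congr 1
  rw [eq_div_iff hD]
  field_simp
  rw [corrDen]
  ring

theorem wdzbar_corr {n : ℝ} (hn : 0 ≤ n) (z₀ : ℂ) {w : ℂ} (hw : w ∈ Metric.ball (0 : ℂ) 1) :
    wdzbar (corr n z₀) w = n ^ 2 * (w - z₀) *
      (-2 * ((1 - ‖w‖ ^ 2 : ℝ) : ℂ) * w - n ^ 2 * ((1 - ‖w‖ ^ 2 : ℝ) : ℂ) ^ 4 * (w - z₀)) /
        (corrDen n z₀ w : ℂ) ^ 2 := by
  have hnorm : ∀ x : ℂ, ((‖x‖ ^ 2 : ℝ) : ℂ) = x * (starRingEnd ℂ) x := fun x => by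
    rw [Complex.mul_conj, Complex.normSq_eq_norm_sq]
  have hD := (corrDen_pos hn z₀ w).ne'
  have hDc : (corrDen n z₀ w : ℂ) ≠ 0 := by exact_mod_cast hD
  have hid : ∀ c : ℂ, DifferentiableAt ℝ (fun x : ℂ => x - c) w :=
    fun c => differentiableAt_id.sub_const c
  have hcj : ∀ c : ℂ, DifferentiableAt ℝ (fun x : ℂ => (starRingEnd ℂ) (x - c)) w :=
    fun c => differentiable_conj_sub c w
  have hsq : ∀ c : ℂ, wdzbar (fun x => (x - c) * (starRingEnd ℂ) (x - c)) w = w - c := fun c => by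
    rw [wdzbar_mul (hid c) (hcj c), wdzbar_sub_const, wdzbar_conj_sub]
    ring
  have hρd : DifferentiableAt ℝ
      (fun x : ℂ => 1 + -1 * ((x - 0) * (starRingEnd ℂ) (x - 0))) w :=
    (((hid 0).fun_mul (hcj 0)).const_mul _).const_add _
  have hρ : wdzbar (fun x : ℂ => 1 + -1 * ((x - 0) * (starRingEnd ℂ) (x - 0))) w = -w := by
    rw [wdzbar_add (differentiableAt_const _) (((hid 0).fun_mul (hcj 0)).const_mul _),
      wdzbar_const_mul ((hid 0).fun_mul (hcj 0)), hsq]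
    simp [wdzbar]
  have hPev : (fun x : ℂ => (discWeight x : ℂ)) =ᶠ[nhds w] fun x =>
      (1 + -1 * ((x - 0) * (starRingEnd ℂ) (x - 0))) *
        (1 + -1 * ((x - 0) * (starRingEnd ℂ) (x - 0))) := by
    filter_upwards [Metric.isOpen_ball.mem_nhds hw] with x hx
    rw [discWeight_of_mem_ball hx, Complex.ofReal_pow, Complex.ofReal_sub, hnorm]
    simp
    ring
  have hPd : DifferentiableAt ℝ (fun x : ℂ => (discWeight x : ℂ)) w :=
    (hρd.fun_mul hρd).congr_of_eventuallyEq hPev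
  have hP : wdzbar (fun x : ℂ => (discWeight x : ℂ)) w =
      -2 * ((1 - ‖w‖ ^ 2 : ℝ) : ℂ) * w := by
    rw [wdzbar_congr hPev, wdzbar_mul hρd hρd, hρ, Complex.ofReal_sub, hnorm]
    simp
    ring
  have hQd : DifferentiableAt ℝ
      (fun x : ℂ => (n : ℂ) ^ 2 * ((x - z₀) * (starRingEnd ℂ) (x - z₀)) + n) w :=
    (((hid z₀).fun_mul (hcj z₀)).const_mul _).add_const _
  have hQ : wdzbar (fun x : ℂ => (n : ℂ) ^ 2 * ((x - z₀) * (starRingEnd ℂ) (x - z₀)) + n) w =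
      n ^ 2 * (w - z₀) := by
    rw [wdzbar_add (((hid z₀).fun_mul (hcj z₀)).const_mul _) (differentiableAt_const _),
      wdzbar_const_mul ((hid z₀).fun_mul (hcj z₀)), hsq]
    simp [wdzbar]
  have hDeq : (fun x : ℂ => (corrDen n z₀ x : ℂ)) = fun x => (discWeight x : ℂ) *
      ((n : ℂ) ^ 2 * ((x - z₀) * (starRingEnd ℂ) (x - z₀)) + n) + 1 := by
    funext x
    rw [← hnorm, corrDen]
    push_cast
    ring
  have hDd : DifferentiableAt ℝ (fun x : ℂ => (corrDen n z₀ x : ℂ)) w := by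
    rw [hDeq]
    exact (hPd.fun_mul hQd).add_const _
  have hDw : wdzbar (fun x : ℂ => (corrDen n z₀ x : ℂ)) w =
      -2 * ((1 - ‖w‖ ^ 2 : ℝ) : ℂ) * w * (n ^ 2 * ‖w - z₀‖ ^ 2 + n) +
        discWeight w * (n ^ 2 * (w - z₀)) := by
    rw [hDeq, wdzbar_add (hPd.fun_mul hQd) (differentiableAt_const _), wdzbar_mul hPd hQd, hP, hQ,
      ← hnorm]
    simp [wdzbar]
  have hcd : DifferentiableAt ℝ (corr n z₀) w := (contDiff_corr hn z₀).differentiable one_ne_zero w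
  have hprod : (fun x => corr n z₀ x * (corrDen n z₀ x : ℂ)) =
      fun x => (n : ℂ) ^ 2 * ((discWeight x : ℂ) * (x - z₀)) := by
    funext x
    have hx : (corrDen n z₀ x : ℂ) ≠ 0 := by exact_mod_cast (corrDen_pos hn z₀ x).ne'
    rw [corr]
    push_cast
    field_simp
  have h := congrArg (fun f => wdzbar f w) hprod
  rw [wdzbar_mul hcd hDd, wdzbar_const_mul (hPd.fun_mul (hid z₀)), wdzbar_mul hPd (hid z₀),
    wdzbar_sub_const, hP, hDw] at h
  have hc : corr n z₀ w = n ^ 2 * discWeight w * (w - z₀) / (corrDen n z₀ w : ℂ) := by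
    rw [corr]
    push_cast
    ring
  have hDv : (corrDen n z₀ w : ℂ) = discWeight w * (n ^ 2 * ‖w - z₀‖ ^ 2 + n) + 1 := by
    rw [corrDen]
    push_cast
    ring
  have hPv : (discWeight w : ℂ) = ((1 - ‖w‖ ^ 2 : ℝ) : ℂ) ^ 2 := by
    rw [discWeight_of_mem_ball hw, Complex.ofReal_pow]
  rw [eq_div_iff (pow_ne_zero 2 hDc)]
  rw [hc, div_mul_eq_mul_div, ← eq_sub_iff_add_eq] at h
  have h2 : wdzbar (corr n z₀) w * (corrDen n z₀ w : ℂ) ^ 2 =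
      (wdzbar (corr n z₀) w * (corrDen n z₀ w : ℂ)) * (corrDen n z₀ w : ℂ) := by ring
  rw [h2, h, sub_mul, div_mul_cancel₀ _ hDc, hDv, hPv]
  ring

theorem norm_corr {n : ℝ} (hn : 0 ≤ n) (z₀ w : ℂ) :
    ‖corr n z₀ w‖ = n ^ 2 * discWeight w / corrDen n z₀ w * ‖w - z₀‖ := by
  have := corrDen_pos hn z₀ w
  have := discWeight_nonneg w
  rw [corr, norm_mul, Complex.norm_real, Real.norm_of_nonneg (by positivity)]

/-! ### Pointwise bounds -/

theorem norm_corr_sq_le {n : ℝ} (hn : 0 < n) (z₀ w : ℂ) :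
    ‖corr n z₀ w‖ ^ 2 ≤ n * (1 / (1 + n * ‖w - z₀‖ ^ 2)) := by
  have hD := corrDen_pos hn.le z₀ w
  have hP := discWeight_nonneg w
  rw [norm_corr hn.le, mul_one_div, le_div_iff₀ (by positivity), div_mul_eq_mul_div, div_pow,
    div_mul_eq_mul_div, div_le_iff₀ (by positivity)]
  set σ := ‖w - z₀‖
  set P := discWeight w
  have h1 : n * P * (1 + n * σ ^ 2) ≤ corrDen n z₀ w := by
    rw [corrDen]
    nlinarith
  have h2 : (n * P * (1 + n * σ ^ 2)) ^ 2 ≤ corrDen n z₀ w ^ 2 := by gcongr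
  calc (n ^ 2 * P * σ) ^ 2 * (1 + n * σ ^ 2)
      = n * ((n * P) ^ 2 * (1 + n * σ ^ 2) * (n * σ ^ 2)) := by ring
    _ ≤ n * ((n * P) ^ 2 * (1 + n * σ ^ 2) * (1 + n * σ ^ 2)) := by gcongr; linarith
    _ = n * (n * P * (1 + n * σ ^ 2)) ^ 2 := by ring
    _ ≤ n * corrDen n z₀ w ^ 2 := by gcongr

theorem one_sub_conj_mul_corr_le {n : ℝ} (hn : 0 < n) (z₀ : ℂ) {w : ℂ}
    (hw : w ∈ Metric.ball (0 : ℂ) 1) :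
    ‖1 - (starRingEnd ℂ) (w - z₀) * corr n z₀ w‖ ≤ 1 / (1 + n * ‖w - z₀‖ ^ 2) +
      1 / (1 + (n * ((1 - ‖w‖ ^ 2) * ‖w - z₀‖)) ^ 2) := by
  have hD := corrDen_pos hn.le z₀ w
  have hP := discWeight_nonneg w
  rw [one_sub_conj_mul_corr hn.le, Complex.norm_real, Real.norm_of_nonneg (by positivity), add_div]
  refine add_le_add ?_ ?_
  · rw [div_le_div_iff₀ hD (by positivity), corrDen]
    nlinarith
  · rw [div_le_div_iff₀ hD (by positivity), corrDen, discWeight_of_mem_ball hw]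
    nlinarith [mul_nonneg hn.le (sq_nonneg (1 - ‖w‖ ^ 2))]

theorem norm_wdzbar_corr_le {n : ℝ} (hn : 0 < n) (z₀ : ℂ) {w : ℂ}
    (hw : w ∈ Metric.ball (0 : ℂ) 1) :
    ‖wdzbar (corr n z₀) w‖ ≤ 2 * n * (1 / (1 + n * ‖w - z₀‖ ^ 2) +
      1 / (1 + (n * ((1 - ‖w‖ ^ 2) * ‖w - z₀‖)) ^ 2)) := by
  have hD := corrDen_pos hn.le z₀ w
  have hDe : corrDen n z₀ w = (1 - ‖w‖ ^ 2) ^ 2 * (n ^ 2 * ‖w - z₀‖ ^ 2 + n) + 1 := by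
    rw [corrDen, discWeight_of_mem_ball hw]
  have hw1 : ‖w‖ < 1 := mem_ball_zero_iff.1 hw
  have hρ : 0 < 1 - ‖w‖ ^ 2 := by nlinarith [norm_nonneg w]
  rw [wdzbar_corr hn.le z₀ hw, norm_div, norm_mul, norm_mul, norm_pow, norm_pow, Complex.norm_real,
    Complex.norm_real, Real.norm_of_nonneg hn.le, Real.norm_of_nonneg hD.le]
  set ρ := 1 - ‖w‖ ^ 2
  set σ := ‖w - z₀‖ with hσ
  set D := corrDen n z₀ w
  have hσ0 : 0 ≤ σ := norm_nonneg _
  have hb : ‖-2 * (ρ : ℂ) * w - n ^ 2 * (ρ : ℂ) ^ 4 * (w - z₀)‖ ≤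
      2 * ρ + n ^ 2 * ρ ^ 4 * σ := by
    refine (norm_sub_le _ _).trans (add_le_add ?_ (le_of_eq ?_))
    · simp only [norm_mul, Complex.norm_real, Real.norm_of_nonneg hρ.le, norm_neg,
        Complex.norm_ofNat]
      nlinarith
    · simp only [norm_mul, norm_pow, Complex.norm_real, Real.norm_of_nonneg hρ.le,
        Real.norm_of_nonneg hn.le, hσ]
  have h1 : n ^ 2 * σ * (2 * ρ) / D ^ 2 ≤ 2 * n * (1 / (1 + (n * (ρ * σ)) ^ 2)) := by
    have hx : n * (ρ * σ) ≤ D := by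
      rw [hDe]
      nlinarith [sq_nonneg (n * (ρ * σ) - 1), mul_nonneg hn.le (sq_nonneg ρ),
        sq_nonneg (n * (ρ * σ))]
    have hy : 1 + (n * (ρ * σ)) ^ 2 ≤ D := by
      rw [hDe]
      nlinarith [mul_nonneg hn.le (sq_nonneg ρ)]
    rw [mul_one_div, div_le_div_iff₀ (by positivity) (by positivity)]
    calc n ^ 2 * σ * (2 * ρ) * (1 + (n * (ρ * σ)) ^ 2)
        = 2 * n * ((n * (ρ * σ)) * (1 + (n * (ρ * σ)) ^ 2)) := by ring
      _ ≤ 2 * n * (D * D) := by gcongr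
      _ = 2 * n * D ^ 2 := by ring
  have h2 : n ^ 2 * σ * (n ^ 2 * ρ ^ 4 * σ) / D ^ 2 ≤ 2 * n * (1 / (1 + n * σ ^ 2)) := by
    have hx : n * ρ ^ 2 * (1 + n * σ ^ 2) ≤ D := by
      rw [hDe]
      nlinarith
    have hy : n ^ 2 * ρ ^ 2 * σ ^ 2 ≤ D := by
      rw [hDe]
      nlinarith [mul_nonneg hn.le (sq_nonneg ρ)]
    rw [mul_one_div, div_le_div_iff₀ (by positivity) (by positivity)]
    calc n ^ 2 * σ * (n ^ 2 * ρ ^ 4 * σ) * (1 + n * σ ^ 2)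
        = n * ((n ^ 2 * ρ ^ 2 * σ ^ 2) * (n * ρ ^ 2 * (1 + n * σ ^ 2))) := by ring
      _ ≤ n * (D * D) := by gcongr
      _ ≤ 2 * n * D ^ 2 := by nlinarith [mul_pos hn (pow_pos hD 2)]
  calc _ ≤ n ^ 2 * σ * (2 * ρ + n ^ 2 * ρ ^ 4 * σ) / D ^ 2 := by gcongr
    _ = n ^ 2 * σ * (2 * ρ) / D ^ 2 + n ^ 2 * σ * (n ^ 2 * ρ ^ 4 * σ) / D ^ 2 := by ring
    _ ≤ _ := by linarith

/-! ### The representation formula -/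

theorem integrableOn_div_sub {g : ℂ → ℂ} (hg : ContinuousOn g (Metric.closedBall 0 1)) {z : ℂ}
    (hz : z ∈ Metric.closedBall (0 : ℂ) 1) :
    IntegrableOn (fun w => g w / (z - w)) (Metric.ball 0 1) := by
  obtain ⟨c, hc⟩ := (isCompact_closedBall (0 : ℂ) 1).exists_bound_of_continuousOn hg
  have hk : IntegrableOn (fun w => (z - w)⁻¹) (Metric.ball 0 1) := by
    refine ⟨Measurable.aestronglyMeasurable (by fun_prop), ?_⟩
    rw [hasFiniteIntegral_iff_enorm]
    have h := (lintegral_enorm_inv_sub_rpow_le 1 hz).trans_lt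
      (lintegral_enorm_inv_rpow_ball_lt_top zero_le_one one_lt_two)
    simpa only [ENNReal.rpow_one] using h
  simp only [div_eq_mul_inv]
  refine hk.bdd_mul (c := c) ((hg.mono Metric.ball_subset_closedBall).aestronglyMeasurable
    measurableSet_ball) ?_
  filter_upwards [ae_restrict_mem measurableSet_ball] with w hw
  exact hc w (Metric.ball_subset_closedBall hw)

theorem continuous_wdzbar {G : ℂ → ℂ} (hG : ContDiff ℝ 1 G) : Continuous (wdzbar G) := by
  have h : Continuous (fderiv ℝ G) := hG.continuous_fderiv one_ne_zero
  unfold wdzbar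
  fun_prop

theorem integral_ball_wdzbar_div_sub {G : ℂ → ℂ} (hG : ContDiff ℝ 1 G)
    (h0 : ∀ w ∉ Metric.closedBall (0 : ℂ) 1, G w = 0) (z : ℂ) :
    ∫ w in Metric.ball (0 : ℂ) 1, wdzbar G w / (z - w) = Real.pi * G z := by
  have hae : (Metric.ball (0 : ℂ) 1 : Set ℂ) =ᵐ[volume] Metric.closedBall 0 1 := by
    refine Metric.ball_subset_closedBall.eventuallyLE.antisymm (ae_le_set.2 ?_)
    rw [Metric.closedBall_sdiff_ball]
    exact Measure.addHaar_sphere volume 0 1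
  rw [← integral_wdzbar_div_sub hG (HasCompactSupport.intro (isCompact_closedBall 0 1) h0),
    setIntegral_congr_set hae]
  refine setIntegral_eq_integral_of_forall_compl_eq_zero fun w hw => ?_
  have h : G =ᶠ[nhds w] fun _ => 0 := by
    filter_upwards [Metric.isClosed_closedBall.isOpen_compl.mem_nhds hw] with x hx using h0 x hx
  rw [wdzbar_congr h]
  simp [wdzbar]

section Representation

variable {n : ℝ} {z₀ : ℂ} {a : ℂ → ℂ} {U : Set ℂ}

theorem contDiff_corr_mul_phase (hn : 0 ≤ n) (hU : IsOpen U)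
    (hUb : Metric.closedBall (0 : ℂ) 1 ⊆ U) (ha : ContDiffOn ℝ 1 a U) :
    ContDiff ℝ 1 fun w => corr n z₀ w * a w * phase n z₀ w := by
  rw [contDiff_iff_contDiffAt]
  intro w
  by_cases hw : w ∈ U
  · exact ((contDiff_corr hn z₀).contDiffAt.mul (ha.contDiffAt (hU.mem_nhds hw))).mul
      (contDiff_phase n z₀).contDiffAt
  · refine (contDiffAt_const (c := (0 : ℂ))).congr_of_eventuallyEq ?_
    filter_upwards [Metric.isClosed_closedBall.isOpen_compl.mem_nhds fun h => hw (hUb h)] with x hx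
    rw [Set.mem_compl_iff, mem_closedBall_zero_iff, not_le] at hx
    rw [corr_eq_zero n z₀ hx.le]
    simp

theorem wdzbar_corr_mul_phase (hn : 0 ≤ n) {w : ℂ} (ha : DifferentiableAt ℝ a w) :
    wdzbar (fun w => corr n z₀ w * a w * phase n z₀ w) w = phase n z₀ w *
      (wdzbar (corr n z₀) w * a w + corr n z₀ w * wdzbar a w +
        -2 * Complex.I * n * ((starRingEnd ℂ) (w - z₀) * corr n z₀ w) * a w) := by
  have hc : DifferentiableAt ℝ (corr n z₀) w := (contDiff_corr hn z₀).differentiable one_ne_zero w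
  have he : DifferentiableAt ℝ (phase n z₀) w := (contDiff_phase n z₀).differentiable one_ne_zero w
  rw [wdzbar_mul (hc.fun_mul ha) he, wdzbar_mul hc ha, wdzbar_phase]
  ring

/-- A majorant of the oscillatory integrand after one integration by parts. -/
noncomputable def cauchyMajorant (n : ℝ) (z₀ : ℂ) (a : ℂ → ℂ) (M : ℝ≥0∞) (w : ℂ) : ℝ≥0∞ :=
  2 * M * (ENNReal.ofReal (1 / (1 + n * ‖w - z₀‖ ^ 2)) +
    ENNReal.ofReal (1 / (1 + (n * ((1 - ‖w‖ ^ 2) * ‖w - z₀‖)) ^ 2))) +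
  ENNReal.ofReal (1 / n) * (‖corr n z₀ w‖ₑ * ‖wdzbar a w‖ₑ)

theorem enorm_sub_wdzbar_le (hn : 0 < n) {w : ℂ} (hw : w ∈ Metric.ball (0 : ℂ) 1)
    (ha : DifferentiableAt ℝ a w) {M : ℝ≥0∞} (hM : ‖a w‖ₑ ≤ M) :
    ‖phase n z₀ w * a w - Complex.I / (2 * n) *
      wdzbar (fun w => corr n z₀ w * a w * phase n z₀ w) w‖ₑ ≤ cauchyMajorant n z₀ a M w := by
  have hnc : (n : ℂ) ≠ 0 := by exact_mod_cast hn.ne'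
  have heq : phase n z₀ w * a w - Complex.I / (2 * n) *
      wdzbar (fun w => corr n z₀ w * a w * phase n z₀ w) w =
      phase n z₀ w * (a w * (1 - (starRingEnd ℂ) (w - z₀) * corr n z₀ w) -
        Complex.I / (2 * n) * (wdzbar (corr n z₀) w * a w) -
        Complex.I / (2 * n) * (corr n z₀ w * wdzbar a w)) := by
    rw [wdzbar_corr_mul_phase hn.le ha]
    field_simp
    linear_combination
      (2 * n * phase n z₀ w * a w * (starRingEnd ℂ) (w - z₀) * corr n z₀ w) * Complex.I_sq
  have hE1 : 0 ≤ 1 / (1 + n * ‖w - z₀‖ ^ 2) := by positivity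
  have hE2 : 0 ≤ 1 / (1 + (n * ((1 - ‖w‖ ^ 2) * ‖w - z₀‖)) ^ 2) := by positivity
  have hI : ‖Complex.I / (2 * (n : ℂ))‖ = 1 / (2 * n) := by
    simp [abs_of_pos hn]
  have hb : ‖phase n z₀ w * a w - Complex.I / (2 * n) *
      wdzbar (fun w => corr n z₀ w * a w * phase n z₀ w) w‖ ≤
      2 * ‖a w‖ * (1 / (1 + n * ‖w - z₀‖ ^ 2) +
        1 / (1 + (n * ((1 - ‖w‖ ^ 2) * ‖w - z₀‖)) ^ 2)) +
      1 / n * (‖corr n z₀ w‖ * ‖wdzbar a w‖) := by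
    rw [heq, norm_mul, norm_phase, one_mul]
    have h1 := one_sub_conj_mul_corr_le hn z₀ hw
    have h2 := norm_wdzbar_corr_le hn z₀ hw
    set E := 1 / (1 + n * ‖w - z₀‖ ^ 2) + 1 / (1 + (n * ((1 - ‖w‖ ^ 2) * ‖w - z₀‖)) ^ 2)
    have h3 : ‖Complex.I / (2 * n) * (wdzbar (corr n z₀) w * a w)‖ ≤ ‖a w‖ * E := by
      rw [norm_mul, norm_mul, hI]
      calc 1 / (2 * n) * (‖wdzbar (corr n z₀) w‖ * ‖a w‖)
          ≤ 1 / (2 * n) * (2 * n * E * ‖a w‖) := by gcongr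
        _ = ‖a w‖ * E := by field_simp
    have h4 : ‖Complex.I / (2 * n) * (corr n z₀ w * wdzbar a w)‖ ≤
        1 / n * (‖corr n z₀ w‖ * ‖wdzbar a w‖) := by
      rw [norm_mul, norm_mul, hI]
      gcongr
      linarith
    have h5 : ‖a w * (1 - (starRingEnd ℂ) (w - z₀) * corr n z₀ w)‖ ≤ ‖a w‖ * E := by
      rw [norm_mul]
      gcongr
    refine (norm_sub_le _ _).trans ((add_le_add (norm_sub_le _ _) le_rfl).trans ?_)
    linarith
  calc _ ≤ 2 * ‖a w‖ₑ * (ENNReal.ofReal (1 / (1 + n * ‖w - z₀‖ ^ 2)) +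
        ENNReal.ofReal (1 / (1 + (n * ((1 - ‖w‖ ^ 2) * ‖w - z₀‖)) ^ 2))) +
      ENNReal.ofReal (1 / n) * (‖corr n z₀ w‖ₑ * ‖wdzbar a w‖ₑ) := by
        rw [← ofReal_norm, ← ofReal_norm, ← ofReal_norm, ← ofReal_norm,
          ← ENNReal.ofReal_add hE1 hE2, ← ENNReal.ofReal_ofNat, ← ENNReal.ofReal_mul (by positivity),
          ← ENNReal.ofReal_mul (by positivity), ← ENNReal.ofReal_mul (by positivity),
          ← ENNReal.ofReal_mul (by positivity), ← ENNReal.ofReal_add (by positivity)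
            (by positivity)]
        exact ENNReal.ofReal_le_ofReal hb
    _ ≤ _ := by
        rw [cauchyMajorant]
        gcongr

theorem enorm_cauchy_phase_mul_le (hn : 0 < n) (hU : IsOpen U)
    (hUb : Metric.closedBall (0 : ℂ) 1 ⊆ U) (ha : ContDiffOn ℝ 1 a U) {M : ℝ≥0∞}
    (hM : ∀ w ∈ Metric.ball (0 : ℂ) 1, ‖a w‖ₑ ≤ M) {z : ℂ} (hz : z ∈ Metric.ball (0 : ℂ) 1) :
    ‖1 / (Real.pi : ℂ) * ∫ w in Metric.ball (0 : ℂ) 1, phase n z₀ w * a w / (z - w)‖ₑ ≤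
      (∫⁻ w in Metric.ball (0 : ℂ) 1, cauchyMajorant n z₀ a M w * ‖(z - w)⁻¹‖ₑ) +
        ENNReal.ofReal (1 / n) * M * ‖corr n z₀ z‖ₑ := by
  set G : ℂ → ℂ := fun w => corr n z₀ w * a w * phase n z₀ w with hG
  have hGd : ContDiff ℝ 1 G := contDiff_corr_mul_phase hn.le hU hUb ha
  have hG0 : ∀ w ∉ Metric.closedBall (0 : ℂ) 1, G w = 0 := fun w hw => by
    rw [mem_closedBall_zero_iff, not_le] at hw
    rw [hG]
    simp [corr_eq_zero n z₀ hw.le]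
  have hz' := Metric.ball_subset_closedBall hz
  have hda : ∀ w ∈ Metric.ball (0 : ℂ) 1, DifferentiableAt ℝ a w := fun w hw =>
    (ha.contDiffAt (hU.mem_nhds (hUb (Metric.ball_subset_closedBall hw)))).differentiableAt
      one_ne_zero
  have hi1 := integrableOn_div_sub (g := fun w => phase n z₀ w * a w)
    ((contDiff_phase n z₀).continuous.continuousOn.mul (ha.continuousOn.mono hUb)) hz'
  have hi2 := integrableOn_div_sub (g := fun w => Complex.I / (2 * n) * wdzbar G w)
    (continuous_const.mul (continuous_wdzbar hGd)).continuousOn hz'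
  have hsplit : ∫ w in Metric.ball (0 : ℂ) 1, phase n z₀ w * a w / (z - w) =
      (∫ w in Metric.ball (0 : ℂ) 1,
        (phase n z₀ w * a w - Complex.I / (2 * n) * wdzbar G w) / (z - w)) +
      Complex.I / (2 * n) * (Real.pi * G z) := by
    have h1 := integral_sub hi1 hi2
    simp only [← sub_div] at h1
    rw [h1, ← integral_ball_wdzbar_div_sub hGd hG0, ← integral_const_mul, sub_add_eq_add_sub,
      eq_sub_iff_add_eq]
    simp only [mul_div_assoc]
  have hpi : (Real.pi : ℂ) ≠ 0 := by exact_mod_cast Real.pi_pos.ne'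
  have hnorm : ‖1 / (Real.pi : ℂ)‖ₑ ≤ 1 := by
    rw [← ofReal_norm, ← ENNReal.ofReal_one]
    refine ENNReal.ofReal_le_ofReal ?_
    rw [norm_div, norm_one, Complex.norm_real, Real.norm_of_nonneg Real.pi_pos.le]
    exact (div_le_one Real.pi_pos).2 (by linarith [Real.pi_gt_three])
  have hI : ‖Complex.I / (2 * (n : ℂ))‖ₑ ≤ ENNReal.ofReal (1 / n) := by
    rw [← ofReal_norm]
    refine ENNReal.ofReal_le_ofReal ?_
    rw [norm_div, Complex.norm_I, norm_mul, Complex.norm_real, Real.norm_of_nonneg hn.le,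
      Complex.norm_ofNat]
    gcongr
    linarith
  rw [hsplit, mul_add]
  refine (enorm_add_le _ _).trans (add_le_add ?_ ?_)
  · rw [enorm_mul]
    calc _ ≤ 1 * ∫⁻ w in Metric.ball (0 : ℂ) 1,
          ‖(phase n z₀ w * a w - Complex.I / (2 * n) * wdzbar G w) / (z - w)‖ₑ := by
          gcongr
          exact enorm_integral_le_lintegral_enorm _
      _ ≤ _ := by
          rw [one_mul]
          refine setLIntegral_mono' measurableSet_ball fun w hw => ?_
          rw [div_eq_mul_inv, enorm_mul]
          gcongr
          exact enorm_sub_wdzbar_le hn hw (hda w hw) (hM w hw)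
  · have : 1 / (Real.pi : ℂ) * (Complex.I / (2 * n) * (Real.pi * G z)) =
        Complex.I / (2 * n) * (a z * corr n z₀ z * phase n z₀ z) := by
      rw [hG]
      field_simp
    have hph : ‖phase n z₀ z‖ₑ = 1 := by
      rw [← ofReal_norm, norm_phase, ENNReal.ofReal_one]
    rw [this, enorm_mul, enorm_mul, enorm_mul, hph, mul_one, mul_assoc]
    gcongr
    exact hM z hz

end Representation

/-! ### Norm estimates -/

/-- The `L^s` norm over the unit disc of a nonnegative function. -/
noncomputable def discNorm (s : ℝ) (f : ℂ → ℝ≥0∞) : ℝ≥0∞ :=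
  (∫⁻ w in Metric.ball (0 : ℂ) 1, f w ^ s) ^ (1 / s)

theorem discNorm_mono {s : ℝ} (hs : 0 < s) {f g : ℂ → ℝ≥0∞}
    (h : ∀ w ∈ Metric.ball (0 : ℂ) 1, f w ≤ g w) : discNorm s f ≤ discNorm s g :=
  ENNReal.rpow_le_rpow (setLIntegral_mono' measurableSet_ball fun w hw =>
    ENNReal.rpow_le_rpow (h w hw) hs.le) (by positivity)

theorem discNorm_const_mul {s : ℝ} (hs : 0 < s) {f : ℂ → ℝ≥0∞} (hf : Measurable f) (c : ℝ≥0∞) :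
    discNorm s (fun w => c * f w) = c * discNorm s f := by
  simp only [discNorm, ENNReal.mul_rpow_of_nonneg _ _ hs.le]
  rw [lintegral_const_mul _ (hf.pow_const s), ENNReal.mul_rpow_of_nonneg _ _ (by positivity),
    ← ENNReal.rpow_mul, mul_one_div_cancel hs.ne', ENNReal.rpow_one]

theorem discNorm_add_le {s : ℝ} (hs : 1 ≤ s) {f g : ℂ → ℝ≥0∞} (hf : Measurable f)
    (hg : Measurable g) : discNorm s (fun w => f w + g w) ≤ discNorm s f + discNorm s g :=
  ENNReal.lintegral_Lp_add_le hf.aemeasurable hg.aemeasurable hs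

theorem discNorm_mul_le {s m p : ℝ} (hs : 0 < s) (hsm : s < m) (h : 1 / s = 1 / m + 1 / p)
    {f g : ℂ → ℝ≥0∞} (hf : Measurable f) (hg : Measurable g) :
    discNorm s (fun w => f w * g w) ≤ discNorm m f * discNorm p g :=
  ENNReal.lintegral_Lp_mul_le_Lq_mul_Lr hs hsm h _ hf.aemeasurable hg.aemeasurable

theorem eLpNorm_eq_discNorm {p : ℝ} (hp : 0 < p) (f : ℂ → ℂ) :
    eLpNorm f (ENNReal.ofReal p) (volume.restrict (Metric.ball (0 : ℂ) 1)) =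
      discNorm p fun w => ‖f w‖ₑ := by
  rw [eLpNorm_eq_lintegral_rpow_enorm_toReal (by simpa using hp) ENNReal.ofReal_ne_top,
    ENNReal.toReal_ofReal hp.le, discNorm]

theorem discNorm_le_of_le_one {s : ℝ} (hs : 1 ≤ s) {f : ℂ → ℝ≥0∞} (hf : ∀ w, f w ≤ 1) {V K : ℝ≥0∞}
    (h : ∫⁻ w in Metric.ball (0 : ℂ) 1, f w ≤ V * K) :
    discNorm s f ≤ V ^ (1 / s) * K ^ (1 / s) := by
  rw [← ENNReal.mul_rpow_of_nonneg _ _ (by positivity)]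
  refine ENNReal.rpow_le_rpow (le_trans (lintegral_mono fun w => ?_) h) (by positivity)
  calc f w ^ s ≤ f w ^ (1 : ℝ) := ENNReal.rpow_le_rpow_of_exponent_ge (hf w) hs
    _ = f w := ENNReal.rpow_one _

theorem discNorm_corr_le {m : ℝ} (hm : 2 ≤ m) {n : ℝ} (hn : 0 < n) (z₀ : ℂ) {V K : ℝ≥0∞}
    (h : ∫⁻ w in Metric.ball (0 : ℂ) 1, ENNReal.ofReal (1 / (1 + n * ‖w - z₀‖ ^ 2)) ≤ V * K) :
    discNorm m (fun w => ‖corr n z₀ w‖ₑ) ≤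
      ENNReal.ofReal (n ^ (1 / 2 : ℝ)) * (V ^ (1 / m) * K ^ (1 / m)) := by
  have hm0 : 0 < m := by linarith
  have hle : ∀ w, ‖corr n z₀ w‖ₑ ^ m ≤
      ENNReal.ofReal (n ^ (m / 2)) * ENNReal.ofReal (1 / (1 + n * ‖w - z₀‖ ^ 2)) := fun w => by
    have hE : 0 ≤ 1 / (1 + n * ‖w - z₀‖ ^ 2) := by positivity
    have hE1 : 1 / (1 + n * ‖w - z₀‖ ^ 2) ≤ 1 := by
      rw [div_le_one (by positivity)]
      nlinarith [mul_nonneg hn.le (sq_nonneg ‖w - z₀‖)]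
    rw [← ofReal_norm, ENNReal.ofReal_rpow_of_nonneg (norm_nonneg _) hm0.le,
      ← ENNReal.ofReal_mul (by positivity)]
    refine ENNReal.ofReal_le_ofReal ?_
    calc ‖corr n z₀ w‖ ^ m = (‖corr n z₀ w‖ ^ 2) ^ (m / 2) := by
          rw [← Real.rpow_natCast, ← Real.rpow_mul (norm_nonneg _)]
          congr 1
          push_cast
          ring
      _ ≤ (n * (1 / (1 + n * ‖w - z₀‖ ^ 2))) ^ (m / 2) :=
          Real.rpow_le_rpow (by positivity) (norm_corr_sq_le hn z₀ w) (by positivity)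
      _ = n ^ (m / 2) * (1 / (1 + n * ‖w - z₀‖ ^ 2)) ^ (m / 2) := Real.mul_rpow hn.le hE
      _ ≤ n ^ (m / 2) * (1 / (1 + n * ‖w - z₀‖ ^ 2)) ^ (1 : ℝ) := by
          gcongr ?_ * ?_
          exact Real.rpow_le_rpow_of_exponent_ge (by positivity) hE1 (by linarith)
      _ = _ := by rw [Real.rpow_one]
  have hpow : ENNReal.ofReal (n ^ (1 / 2 : ℝ)) = ENNReal.ofReal (n ^ (m / 2)) ^ (1 / m) := by
    rw [ENNReal.ofReal_rpow_of_nonneg (by positivity) (by positivity), ← Real.rpow_mul hn.le]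
    congr 2
    field_simp
  rw [hpow, ← ENNReal.mul_rpow_of_nonneg _ _ (by positivity),
    ← ENNReal.mul_rpow_of_nonneg _ _ (by positivity)]
  refine ENNReal.rpow_le_rpow (le_trans (lintegral_mono hle) ?_) (by positivity)
  rw [lintegral_const_mul' _ _ ENNReal.ofReal_ne_top]
  gcongr

theorem measurable_wdz (a : ℂ → ℂ) : Measurable (wdz a) := by
  have h1 := measurable_fderiv_apply_const ℝ a 1
  have h2 := measurable_fderiv_apply_const ℝ a Complex.I
  exact (h1.sub (h2.const_mul _)).div_const _

theorem measurable_wdzbar (a : ℂ → ℂ) : Measurable (wdzbar a) := by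
  have h1 := measurable_fderiv_apply_const ℝ a 1
  have h2 := measurable_fderiv_apply_const ℝ a Complex.I
  exact (h1.add (h2.const_mul _)).div_const _

theorem norm_fderiv_le_wdz_add_wdzbar (a : ℂ → ℂ) (w : ℂ) :
    ‖fderiv ℝ a w‖ ≤ ‖wdz a w‖ + ‖wdzbar a w‖ := by
  refine ContinuousLinearMap.opNorm_le_bound _ (by positivity) fun v => ?_
  have h : fderiv ℝ a w v = wdz a w * v + wdzbar a w * (starRingEnd ℂ) v := by
    have h1 := fderiv_apply_complex a w v.re v.im
    rw [Complex.re_add_im] at h1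
    have h2 : (starRingEnd ℂ) v = v.re - v.im * Complex.I := by
      apply Complex.ext <;> simp
    rw [h1, h2, wdz, wdzbar]
    nth_rewrite 3 [← Complex.re_add_im v]
    linear_combination (v.im * fderiv ℝ a w Complex.I) * Complex.I_sq
  rw [h, add_mul]
  refine (norm_add_le _ _).trans ?_
  rw [norm_mul, norm_mul, Complex.norm_conj]

theorem eLpNorm_fderiv_le (a : ℂ → ℂ) {p : ℝ≥0∞} (hp : 1 ≤ p) (μ : Measure ℂ) :
    eLpNorm (fderiv ℝ a) p μ ≤ eLpNorm (wdz a) p μ + eLpNorm (wdzbar a) p μ := by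
  refine (eLpNorm_mono_real (norm_fderiv_le_wdz_add_wdzbar a)).trans ?_
  refine (eLpNorm_add_le (measurable_wdz a).norm.aestronglyMeasurable
    (measurable_wdzbar a).norm.aestronglyMeasurable hp).trans (le_of_eq ?_)
  rw [eLpNorm_norm, eLpNorm_norm]

theorem eLpNorm_ball_lt_top {g : ℂ → ℂ} (hg : ContinuousOn g (Metric.closedBall 0 1)) (p : ℝ≥0∞) :
    eLpNorm g p (volume.restrict (Metric.ball (0 : ℂ) 1)) < ∞ := by
  obtain ⟨c, hc⟩ := (isCompact_closedBall (0 : ℂ) 1).exists_bound_of_continuousOn hg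
  have : IsFiniteMeasure (volume.restrict (Metric.ball (0 : ℂ) 1)) :=
    isFiniteMeasure_restrict.2 measure_ball_lt_top.ne
  refine (MemLp.of_bound ((hg.mono Metric.ball_subset_closedBall).aestronglyMeasurable
    measurableSet_ball) c ?_).2
  filter_upwards [ae_restrict_mem measurableSet_ball] with w hw
  exact hc w (Metric.ball_subset_closedBall hw)

theorem measurable_cauchyMajorant {n : ℝ} (hn : 0 ≤ n) (z₀ : ℂ) (a : ℂ → ℂ) (M : ℝ≥0∞) :
    Measurable (cauchyMajorant n z₀ a M) := by
  have h1 := measurable_wdzbar a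
  have h2 := (contDiff_corr hn z₀).continuous.measurable
  unfold cauchyMajorant
  fun_prop

theorem discNorm_cauchy_le {f : ℂ → ℝ≥0∞} (hf : Measurable f) {p q s : ℝ} (hp : 0 < p)
    (hq : 0 < q) (hs : 0 < s) (hqp : q ≤ p) (hsp : s ≤ p) (hpqs : 1 + 1 / p = 1 / q + 1 / s) :
    discNorm p (fun z => ∫⁻ w in Metric.ball (0 : ℂ) 1, f w * ‖(z - w)⁻¹‖ₑ) ≤
      (∫⁻ u in Metric.ball (0 : ℂ) 2, ‖u⁻¹‖ₑ ^ q) ^ (1 / q) * discNorm s f := by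
  refine (ENNReal.rpow_le_rpow (lintegral_cauchy_rpow_le hf hp hq hs hqp hsp hpqs)
    (by positivity)).trans (le_of_eq ?_)
  rw [ENNReal.mul_rpow_of_nonneg _ _ (by positivity), ← ENNReal.rpow_mul, ← ENNReal.rpow_mul,
    discNorm]
  congr 2 <;> field_simp

/-- The estimate for the Cauchy transform in extended norms, with free exponents. -/
theorem discNorm_cauchy_phase_mul_le {p q s m δ e : ℝ} (hp : 2 ≤ p) (hq : 0 < q) (hs : 1 ≤ s)
    (hm : 2 ≤ m) (hqp : q ≤ p) (hsp : s ≤ p) (hsm : s < m) (hpqs : 1 + 1 / p = 1 / q + 1 / s)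
    (hsmp : 1 / s = 1 / m + 1 / p) (h0 : 0 ≤ δ) (h1 : δ < 1) (hes : -(1 - δ) * (1 / s) ≤ e)
    (hem : -1 / 2 - (1 - δ) * (1 / m) ≤ e) (hep : -1 / 2 - (1 - δ) * (1 / p) ≤ e)
    {K : ℝ≥0∞} (hK1 : ∫⁻ u in Metric.ball (0 : ℂ) 2, ‖u⁻¹‖ₑ ^ (2 * (1 - δ)) ≤ K)
    (hK2 : ∫⁻ v in Metric.ball (0 : ℂ) 1,
      ENNReal.ofReal ((1 - ‖v‖ ^ 2) * |v.im|) ^ (-(1 - δ)) ≤ K)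
    {n : ℝ} (hn : 1 < n) {z₀ : ℂ} (hz₀ : z₀ ∈ Metric.closedBall (0 : ℂ) 1) {a : ℂ → ℂ} {U : Set ℂ}
    (hU : IsOpen U) (hUb : Metric.closedBall (0 : ℂ) 1 ⊆ U) (ha : ContDiffOn ℝ 1 a U) {M : ℝ≥0∞}
    (hM : ∀ w ∈ Metric.ball (0 : ℂ) 1, ‖a w‖ₑ ≤ M) :
    discNorm p (fun z => ‖1 / (Real.pi : ℂ) *
        ∫ w in Metric.ball (0 : ℂ) 1, phase n z₀ w * a w / (z - w)‖ₑ) ≤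
      ENNReal.ofReal (n ^ e) *
        ((∫⁻ u in Metric.ball (0 : ℂ) 2, ‖u⁻¹‖ₑ ^ q) ^ (1 / q) *
          (4 * M * K ^ (1 / s) + K ^ (1 / m) * discNorm p fun w => ‖wdzbar a w‖ₑ) +
        M * K ^ (1 / p)) := by
  have hn0 : 0 < n := by linarith
  have hs0 : 0 < s := by linarith
  have hp0 : 0 < p := by linarith
  set V := ENNReal.ofReal (n ^ (-(1 - δ))) with hV
  set X := ENNReal.ofReal (n ^ e) with hX
  set E₁ : ℂ → ℝ≥0∞ := fun w => ENNReal.ofReal (1 / (1 + n * ‖w - z₀‖ ^ 2)) with hE₁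
  set E₂ : ℂ → ℝ≥0∞ := fun w =>
    ENNReal.ofReal (1 / (1 + (n * ((1 - ‖w‖ ^ 2) * ‖w - z₀‖)) ^ 2)) with hE₂
  set H : ℂ → ℝ≥0∞ := fun w => ‖corr n z₀ w‖ₑ with hH
  set B : ℂ → ℝ≥0∞ := fun w => ‖wdzbar a w‖ₑ with hB
  have hcorr := (contDiff_corr hn0.le z₀).continuous
  have hBm : Measurable B := (measurable_wdzbar a).enorm
  have hHm : Measurable H := hcorr.measurable.enorm
  have hE₁m : Measurable E₁ := by fun_prop
  have hE₂m : Measurable E₂ := by fun_prop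
  have hle1 : ∀ x : ℝ, 0 ≤ x → ENNReal.ofReal (1 / (1 + x)) ≤ 1 := fun x hx => by
    rw [← ENNReal.ofReal_one]
    exact ENNReal.ofReal_le_ofReal ((div_le_one (by positivity)).2 (by linarith))
  have hI₁ : ∫⁻ w in Metric.ball (0 : ℂ) 1, E₁ w ≤ V * K :=
    (lintegral_ball_one_div_one_add_le h0 h1.le hn0 hz₀).trans (by gcongr)
  have hI₂ : ∫⁻ w in Metric.ball (0 : ℂ) 1, E₂ w ≤ V * K :=
    (lintegral_ball_one_div_one_add_boundary_le h0 h1 hn0 z₀).trans (by gcongr)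
  have hVpow : ∀ t : ℝ, 0 ≤ t → V ^ t = ENNReal.ofReal (n ^ (-(1 - δ) * t)) := fun t ht => by
    rw [hV, ENNReal.ofReal_rpow_of_nonneg (by positivity) ht, ← Real.rpow_mul hn0.le]
  have hVs : V ^ (1 / s) ≤ X := by
    rw [hVpow _ (by positivity)]
    exact ENNReal.ofReal_le_ofReal (Real.rpow_le_rpow_of_exponent_le hn.le hes)
  have hN₁ : discNorm s E₁ ≤ X * K ^ (1 / s) :=
    (discNorm_le_of_le_one hs (fun w => hle1 _ (by positivity)) hI₁).trans (by gcongr)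
  have hN₂ : discNorm s E₂ ≤ X * K ^ (1 / s) :=
    (discNorm_le_of_le_one hs (fun w => hle1 _ (by positivity)) hI₂).trans (by gcongr)
  have hNH : ∀ t : ℝ, 2 ≤ t → -1 / 2 - (1 - δ) * (1 / t) ≤ e →
      ENNReal.ofReal (1 / n) * discNorm t H ≤ X * K ^ (1 / t) := fun t ht het => by
    have ht0 : 0 < t := by linarith
    calc ENNReal.ofReal (1 / n) * discNorm t H
        ≤ ENNReal.ofReal (1 / n) *
          (ENNReal.ofReal (n ^ (1 / 2 : ℝ)) * (V ^ (1 / t) * K ^ (1 / t))) := by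
          gcongr
          exact discNorm_corr_le ht hn0 z₀ hI₁
      _ = ENNReal.ofReal (n ^ (-1 / 2 - (1 - δ) * (1 / t))) * K ^ (1 / t) := by
          rw [hVpow _ (by positivity), ← mul_assoc, ← mul_assoc,
            ← ENNReal.ofReal_mul (by positivity), ← ENNReal.ofReal_mul (by positivity)]
          congr 2
          rw [one_div n, ← Real.rpow_neg_one, ← Real.rpow_add hn0, ← Real.rpow_add hn0]
          congr 1
          ring
      _ ≤ X * K ^ (1 / t) := by
          gcongr
          exact ENNReal.ofReal_le_ofReal (Real.rpow_le_rpow_of_exponent_le hn.le het)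
  have hmaj : discNorm s (cauchyMajorant n z₀ a M) ≤
      X * (4 * M * K ^ (1 / s) + K ^ (1 / m) * discNorm p B) := by
    calc discNorm s (cauchyMajorant n z₀ a M)
        ≤ discNorm s (fun w => 2 * M * (E₁ w + E₂ w)) +
          discNorm s (fun w => ENNReal.ofReal (1 / n) * (H w * B w)) :=
          discNorm_add_le hs (by fun_prop) ((hHm.mul hBm).const_mul _)
      _ = 2 * M * discNorm s (fun w => E₁ w + E₂ w) +
          ENNReal.ofReal (1 / n) * discNorm s (fun w => H w * B w) := by
          rw [discNorm_const_mul hs0 (by fun_prop), discNorm_const_mul hs0 (by fun_prop)]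
      _ ≤ 2 * M * (X * K ^ (1 / s) + X * K ^ (1 / s)) +
          ENNReal.ofReal (1 / n) * (discNorm m H * discNorm p B) := by
          gcongr
          · exact (discNorm_add_le hs hE₁m hE₂m).trans (add_le_add hN₁ hN₂)
          · exact discNorm_mul_le hs0 hsm hsmp hHm hBm
      _ ≤ 2 * M * (X * K ^ (1 / s) + X * K ^ (1 / s)) + X * K ^ (1 / m) * discNorm p B := by
          rw [← mul_assoc (ENNReal.ofReal (1 / n))]
          exact add_le_add le_rfl (mul_le_mul_left (hNH m hm hem) _)
      _ = _ := by ring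
  have hfm := measurable_cauchyMajorant hn0.le z₀ a M
  have hAm : Measurable fun z => ∫⁻ w in Metric.ball (0 : ℂ) 1,
      cauchyMajorant n z₀ a M w * ‖(z - w)⁻¹‖ₑ :=
    Measurable.lintegral_prod_right' (f := fun x : ℂ × ℂ =>
      cauchyMajorant n z₀ a M x.2 * ‖(x.1 - x.2)⁻¹‖ₑ) (by fun_prop)
  calc _ ≤ discNorm p (fun z => (∫⁻ w in Metric.ball (0 : ℂ) 1,
          cauchyMajorant n z₀ a M w * ‖(z - w)⁻¹‖ₑ) + ENNReal.ofReal (1 / n) * M * H z) :=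
        discNorm_mono hp0 fun z hz => enorm_cauchy_phase_mul_le hn0 hU hUb ha hM hz
    _ ≤ discNorm p (fun z => ∫⁻ w in Metric.ball (0 : ℂ) 1,
          cauchyMajorant n z₀ a M w * ‖(z - w)⁻¹‖ₑ) +
        discNorm p (fun z => ENNReal.ofReal (1 / n) * M * H z) :=
        discNorm_add_le (by linarith) hAm (by fun_prop)
    _ ≤ (∫⁻ u in Metric.ball (0 : ℂ) 2, ‖u⁻¹‖ₑ ^ q) ^ (1 / q) *
          (X * (4 * M * K ^ (1 / s) + K ^ (1 / m) * discNorm p B)) + M * (X * K ^ (1 / p)) := by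
        refine add_le_add ((discNorm_cauchy_le hfm hp0 hq hs0 hqp hsp hpqs).trans (by gcongr)) ?_
        rw [discNorm_const_mul hp0 hHm, mul_comm (ENNReal.ofReal (1 / n)), mul_assoc]
        exact mul_le_mul_right (hNH p hp hep) _
    _ = _ := by ring

/-- `‖𝒞(e^{-inR} a)‖_p ≤ C n^{r - 1/p*} ‖a‖_{W^{1,p}}` in extended norms. -/
theorem exists_eLpNorm_cauchy_phase_mul_le {p r : ℝ} (hp : 2 < p) (hr : 0 < r) :
    ∃ C : ℝ≥0∞, C ≠ ∞ ∧ ∀ n : ℝ, 1 < n → ∀ z₀ ∈ Metric.closedBall (0 : ℂ) 1, ∀ a : ℂ → ℂ,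
      (∃ U : Set ℂ, IsOpen U ∧ Metric.closedBall (0 : ℂ) 1 ⊆ U ∧ ContDiffOn ℝ 1 a U) →
      eLpNorm (fun z : ℂ => 1 / (Real.pi : ℂ) *
          ∫ w in Metric.ball (0 : ℂ) 1, phase n z₀ w * a w / (z - w))
        (ENNReal.ofReal p) (volume.restrict (Metric.ball (0 : ℂ) 1)) ≤
      C * ENNReal.ofReal (n ^ (r - (1 / 2 + 1 / p))) *
        (eLpNorm a (ENNReal.ofReal p) (volume.restrict (Metric.ball (0 : ℂ) 1)) +
        eLpNorm (wdz a) (ENNReal.ofReal p) (volume.restrict (Metric.ball (0 : ℂ) 1)) +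
        eLpNorm (wdzbar a) (ENNReal.ofReal p) (volume.restrict (Metric.ball (0 : ℂ) 1))) := by
  have hp0 : 0 < p := by linarith
  have hx0 : 0 < 1 / p := by positivity
  have hx2 : 1 / p < 1 / 2 := one_div_lt_one_div_of_lt two_pos hp
  obtain ⟨δ, hδ0, hδ1, hδr⟩ : ∃ δ : ℝ, 0 < δ ∧ δ ≤ 1 / 4 ∧ 2 * δ ≤ r :=
    ⟨min (r / 2) (1 / 4), by positivity, min_le_right _ _, by linarith [min_le_left (r / 2) (1 / 4)]⟩
  set x := 1 / p with hx
  have hpx : p = 1 / x := by rw [hx, one_div_one_div]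
  obtain ⟨CM, hCM, hmorrey⟩ := exists_enorm_le_eLpNorm_add_fderiv hp
  set q := 1 / (1 / 2 + δ) with hq
  set s := 1 / (1 / 2 + x - δ) with hs
  set m := 1 / (1 / 2 - δ) with hm
  have hs0 : 0 < 1 / 2 + x - δ := by linarith
  have hm0 : 0 < 1 / 2 - δ := by linarith
  have hq' : 1 / q = 1 / 2 + δ := one_div_one_div _
  have hs' : 1 / s = 1 / 2 + x - δ := one_div_one_div _
  have hm' : 1 / m = 1 / 2 - δ := one_div_one_div _
  have hq0 : 0 < q := by positivity
  have hq2 : q < 2 := by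
    rw [hq, div_lt_iff₀ (by positivity)]
    linarith
  have hs1 : 1 ≤ s := by
    rw [hs, le_div_iff₀ hs0]
    linarith
  have hm2 : 2 ≤ m := by
    rw [hm, le_div_iff₀ hm0]
    linarith
  have hsp : s ≤ p := by
    rw [hpx]
    exact one_div_le_one_div_of_le hx0 (by linarith)
  have hsm : s < m := one_div_lt_one_div_of_lt hm0 (by linarith)
  set K₁ := ∫⁻ u in Metric.ball (0 : ℂ) 2, ‖u⁻¹‖ₑ ^ (2 * (1 - δ)) with hK₁
  set K₂ := ∫⁻ v in Metric.ball (0 : ℂ) 1,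
    ENNReal.ofReal ((1 - ‖v‖ ^ 2) * |v.im|) ^ (-(1 - δ)) with hK₂
  set Q := ∫⁻ u in Metric.ball (0 : ℂ) 2, ‖u⁻¹‖ₑ ^ q with hQ
  have hK₁t : K₁ < ∞ := lintegral_enorm_inv_rpow_ball_lt_top (by linarith) (by linarith)
  have hK₂t : K₂ < ∞ := lintegral_ball_boundary_weight_lt_top (by linarith) (by linarith)
  have hQt : Q < ∞ := lintegral_enorm_inv_rpow_ball_lt_top hq0.le hq2
  set K := K₁ + K₂
  have hKt : K ≠ ∞ := by finiteness
  have hpow : ∀ t : ℝ, 0 ≤ t → K ^ t ≠ ∞ := fun t ht => ENNReal.rpow_ne_top_of_nonneg ht hKt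
  have hQpow : Q ^ (1 / q) ≠ ∞ := ENNReal.rpow_ne_top_of_nonneg (by positivity) hQt.ne
  have hKs := hpow (1 / s) (by positivity)
  have hKm := hpow (1 / m) (by positivity)
  have hKp := hpow x hx0.le
  refine ⟨Q ^ (1 / q) * (4 * CM * K ^ (1 / s) + K ^ (1 / m)) + CM * K ^ x, by finiteness, ?_⟩
  rintro n hn z₀ hz₀ a ⟨U, hU, hUb, ha⟩
  have hball : Metric.ball (0 : ℂ) 1 ⊆ U := Metric.ball_subset_closedBall.trans hUb
  set W := eLpNorm a (ENNReal.ofReal p) (volume.restrict (Metric.ball (0 : ℂ) 1)) +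
    eLpNorm (wdz a) (ENNReal.ofReal p) (volume.restrict (Metric.ball (0 : ℂ) 1)) +
    eLpNorm (wdzbar a) (ENNReal.ofReal p) (volume.restrict (Metric.ball (0 : ℂ) 1)) with hW
  have hM : ∀ w ∈ Metric.ball (0 : ℂ) 1, ‖a w‖ₑ ≤ CM * W := fun w hw => by
    refine (hmorrey a (fun z hz => (ha.contDiffAt (hU.mem_nhds (hball hz))).differentiableAt
      one_ne_zero) ((ha.continuousOn_fderiv_of_isOpen hU le_rfl).mono hball) w hw).trans ?_
    rw [hW, add_assoc]
    gcongr
    refine eLpNorm_fderiv_le a ?_ _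
    rw [← ENNReal.ofReal_one]
    exact ENNReal.ofReal_le_ofReal (by linarith)
  have hB : discNorm p (fun w => ‖wdzbar a w‖ₑ) ≤ W := by
    rw [← eLpNorm_eq_discNorm hp0]
    exact le_add_self
  rw [eLpNorm_eq_discNorm hp0]
  refine (discNorm_cauchy_phase_mul_le (K := K) (m := m) (δ := δ) (e := r - (1 / 2 + x)) hp.le hq0
    hs1 hm2 (hq2.le.trans hp.le) hsp hsm (by rw [hq', hs']; ring) (by rw [hs', hm']; ring) hδ0.le
    (by linarith) (by rw [hs']; nlinarith) (by rw [hm']; nlinarith) (by rw [← hx]; nlinarith)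
    le_self_add le_add_self hn hz₀ hU hUb ha hM).trans ?_
  rw [← hx]
  calc _ ≤ ENNReal.ofReal (n ^ (r - (1 / 2 + x))) *
        (Q ^ (1 / q) * (4 * (CM * W) * K ^ (1 / s) + K ^ (1 / m) * W) + CM * W * K ^ x) := by
        gcongr
    _ = _ := by ring

/-- For `2 < p < ∞`, `1/p* = 1/2 + 1/p`, `r > 0` there is `C_{r,p} < ∞` such that for all
`n > 1`, `z₀` in the closed unit disc, and `a` which is `C¹` near the closed unit disc,
`‖𝒞(e^{-inR(·,z₀)} a)‖_{L^p(Ω)} ≤ C_{r,p} n^{r - 1/p*} ‖a‖_{W^{1,p}(Ω)}`. -/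
theorem stmt_10 (p ps r : ℝ) (hp : 2 < p) (hps : 1 / ps = 1 / 2 + 1 / p) (hr : 0 < r) :
    ∃ C : ℝ, 0 ≤ C ∧ ∀ n : ℝ, 1 < n → ∀ z₀ ∈ Metric.closedBall (0 : ℂ) 1,
      ∀ a : ℂ → ℂ,
        (∃ U : Set ℂ, IsOpen U ∧ Metric.closedBall (0 : ℂ) 1 ⊆ U ∧ ContDiffOn ℝ 1 a U) →
        (eLpNorm (fun z : ℂ => (1 / (Real.pi : ℂ)) *
            ∫ w in Metric.ball (0 : ℂ) 1,
              Complex.exp (-Complex.I * (n : ℂ) *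
                ((w - z₀) ^ 2 + ((starRingEnd ℂ) (w - z₀)) ^ 2)) * a w / (z - w))
          (ENNReal.ofReal p) (volume.restrict (Metric.ball (0 : ℂ) 1))).toReal ≤
        C * n ^ (r - 1 / ps) * W1Norm a p := by
  obtain ⟨C, hC, h⟩ := exists_eLpNorm_cauchy_phase_mul_le hp hr
  refine ⟨C.toReal, ENNReal.toReal_nonneg, fun n hn z₀ hz₀ a ha => ?_⟩
  have hle := h n hn z₀ hz₀ a ha
  obtain ⟨U, hU, hUb, ha⟩ := ha
  have hD : ContinuousOn (fderiv ℝ a) (Metric.closedBall 0 1) :=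
    (ha.continuousOn_fderiv_of_isOpen hU le_rfl).mono hUb
  have hDv : ∀ v : ℂ, ContinuousOn (fun w => fderiv ℝ a w v) (Metric.closedBall 0 1) :=
    fun v => hD.clm_apply continuousOn_const
  have h1 := eLpNorm_ball_lt_top (ha.continuousOn.mono hUb) (ENNReal.ofReal p)
  have h2 := eLpNorm_ball_lt_top (g := wdz a)
    (((hDv 1).sub (continuousOn_const.mul (hDv Complex.I))).div_const _) (ENNReal.ofReal p)
  have h3 := eLpNorm_ball_lt_top (g := wdzbar a)
    (((hDv 1).add (continuousOn_const.mul (hDv Complex.I))).div_const _) (ENNReal.ofReal p)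
  have hn0 : 0 ≤ n ^ (r - (1 / 2 + 1 / p)) := Real.rpow_nonneg (by linarith) _
  have hreal := ENNReal.toReal_mono (by finiteness) hle
  rw [ENNReal.toReal_mul, ENNReal.toReal_mul, ENNReal.toReal_ofReal hn0,
    ENNReal.toReal_add (by finiteness) h3.ne, ENNReal.toReal_add h1.ne h2.ne] at hreal
  rw [hps]
  exact hreal
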